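/- arXiv:2601.00957 — 5 statements merged into one kernel-verified Lean document; each statement's English description precedes it below -/
import Mathlib

section
/- Let G be an indecomposable non-split unigraph with at least two vertices. Then G or its complement is isomorphic to one of the following graphs: the 5-cycle C_5; mK_2 (the disjoint union of m copies of K_2) with m ≥ 2; U_2(m,ℓ) with m ≥ 1 and ℓ ≥ 2; or U_3(m) with m ≥ 1. -/
namespace Tysh

open SimpleGraph

variable {V : Type}

/-- A set of vertices is independent (stable). -/
def IsIndep (G : SimpleGraph V) (s : Set V) : Prop :=
  ∀ ⦃u⦄, u ∈ s → ∀ ⦃v⦄, v ∈ s → u ≠ v → ¬ G.Adj u v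

/-- `(A, B)` is a KS-partition of `G`: `A` induces a clique, `B` an independent set,
and they partition the vertex set. -/
def IsKSPartition (G : SimpleGraph V) (A B : Set V) : Prop :=
  G.IsClique A ∧ IsIndep G B ∧ A ∪ B = Set.univ ∧ Disjoint A B

/-- A split graph is one admitting a KS-partition. -/
def IsSplit (G : SimpleGraph V) : Prop := ∃ A B, IsKSPartition G A B

/-- Independence number. -/
noncomputable def indepNum (G : SimpleGraph V) : ℕ := Gᶜ.cliqueNum

/-- `G` is decomposable: its vertices can be partitioned into `A ∪ B` (a nonempty split
graph with KS-partition `(A,B)`) and a nonempty part `W`, with all `A`–`W` edges present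
and no `B`–`W` edges; i.e. `G` is (isomorphic to) the composition `(G[A∪B],A,B) ∘ G[W]`. -/
def Decomposable (G : SimpleGraph V) : Prop :=
  ∃ A B W : Set V,
    (A ∪ B) ∪ W = Set.univ ∧ Disjoint A B ∧ Disjoint (A ∪ B) W ∧
    (A ∪ B).Nonempty ∧ W.Nonempty ∧
    G.IsClique A ∧ IsIndep G B ∧
    (∀ a ∈ A, ∀ w ∈ W, G.Adj a w) ∧
    (∀ b ∈ B, ∀ w ∈ W, ¬ G.Adj b w)

/-- The composition `(G,A,B) ∘ H` of a split graph `G` (with clique part `A`)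
with a graph `H`. -/
def comp {α β : Type} (G : SimpleGraph α) (A : Set α) (H : SimpleGraph β) :
    SimpleGraph (α ⊕ β) :=
  SimpleGraph.fromRel (fun x y =>
    match x, y with
    | .inl a, .inl a' => G.Adj a a'
    | .inr b, .inr b' => H.Adj b b'
    | .inl a, .inr _ => a ∈ A
    | .inr _, .inl _ => False)

/-- The iterated composition `(G_k,A_k,B_k) ∘ ⋯ ∘ (G_1,A_1,B_1) ∘ G_0`
(component `0` is `G_0`; the clique part `A i` of component `i` is joined to
all components with smaller index). -/
def iterComp {k : ℕ} {Vi : Fin (k+1) → Type} (Gi : ∀ i, SimpleGraph (Vi i))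
    (A : ∀ i, Set (Vi i)) : SimpleGraph (Σ i, Vi i) :=
  SimpleGraph.fromRel (fun x y =>
    (∃ h : x.1 = y.1, (Gi y.1).Adj (h ▸ x.2) y.2) ∨ (y.1 < x.1 ∧ x.2 ∈ A x.1))

/-- The multiset of vertex degrees of a finite graph. -/
noncomputable def degMultiset {V : Type} [Fintype V] (G : SimpleGraph V) : Multiset ℕ :=
  Finset.univ.val.map fun v => (G.neighborSet v).ncard

/-- A unigraph is a graph determined up to isomorphism by its degree sequence. -/
def Unigraph {V : Type} [Fintype V] (G : SimpleGraph V) : Prop :=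
  ∀ (W : Type) [Fintype W] (H : SimpleGraph W),
    degMultiset G = degMultiset H → Nonempty (G ≃g H)

/-- The 5-cycle. -/
def C5 : SimpleGraph (ZMod 5) := SimpleGraph.fromRel (fun x y => y = x + 1)

/-- `m` disjoint copies of `K₂`. -/
def mK2 (m : ℕ) : SimpleGraph (Fin m × Fin 2) := SimpleGraph.fromRel (fun p q => p.1 = q.1)

/-- `U₂(m,ℓ)`: disjoint union of `m K₂` and the star `K_{1,ℓ}` (center `Sum.inr none`). -/
def U2 (m ℓ : ℕ) : SimpleGraph ((Fin m × Fin 2) ⊕ Option (Fin ℓ)) :=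
  SimpleGraph.fromRel (fun x y =>
    match x, y with
    | .inl p, .inl q => p.1 = q.1
    | .inr a, .inr _ => a = none
    | _, _ => False)

/-- `U₃(m)`: a center vertex (`none`) joined to all vertices of `m K₂` and to the two
endpoints of a path `P₃`. -/
def U3 (m : ℕ) : SimpleGraph (Option ((Fin m × Fin 2) ⊕ Fin 3)) :=
  SimpleGraph.fromRel (fun x y =>
    match x, y with
    | some (.inl p), some (.inl q) => p.1 = q.1
    | some (.inr i), some (.inr j) => (j : ℕ) = (i : ℕ) + 1
    | none, some (.inl _) => True
    | none, some (.inr i) => i = 0 ∨ i = 2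
    | _, _ => False)

/-- `S(p,q)`: `q` copies of the star `K_{1,p}` with the `q` centers (`(j, none)`)
pairwise adjacent. -/
def Spq (p q : ℕ) : SimpleGraph (Fin q × Option (Fin p)) :=
  SimpleGraph.fromRel (fun x y => x.2 = none ∧ (y.2 = none ∨ x.1 = y.1))

/-- `S₂(p₁,q₁,…,p_m,q_m)`: for each `i`, `q i` copies of the star `K_{1, p i}`,
with all star centers pairwise adjacent. -/
def S2g {m : ℕ} (p q : Fin m → ℕ) :
    SimpleGraph (Σ i : Fin m, Fin (q i) × Option (Fin (p i))) :=
  SimpleGraph.fromRel (fun x y =>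
    x.2.2 = none ∧ (y.2.2 = none ∨ (x.1 = y.1 ∧ (x.2.1 : ℕ) = (y.2.1 : ℕ))))

/-- `S₃(p,q₁,q₂)`: `S(p,q₁)` and `S(p+1,q₂)` with all star centers pairwise adjacent,
plus a vertex `e` (`none`) adjacent exactly to the `q₁` centers of the stars of `S(p,q₁)`. -/
def S3g (p q₁ q₂ : ℕ) :
    SimpleGraph (Option ((Fin q₁ × Option (Fin p)) ⊕ (Fin q₂ × Option (Fin (p+1))))) :=
  SimpleGraph.fromRel (fun x y =>
    match x, y with
    | some (.inl a), some (.inl b) => a.2 = none ∧ (b.2 = none ∨ a.1 = b.1)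
    | some (.inl a), some (.inr b) => a.2 = none ∧ b.2 = none
    | some (.inr a), some (.inl b) => a.2 = none ∧ b.2 = none
    | some (.inr a), some (.inr b) => a.2 = none ∧ (b.2 = none ∨ a.1 = b.1)
    | none, some (.inl a) => a.2 = none
    | _, _ => False)

/-- `S₄(p,q)`: `S₃(p,2,q)` together with a vertex `f` (`none`) adjacent to all vertices
of `S₃(p,2,q)` except `e` (`some none`). -/
def S4g (p q : ℕ) :
    SimpleGraph (Option (Option ((Fin 2 × Option (Fin p)) ⊕ (Fin q × Option (Fin (p+1)))))) :=
  SimpleGraph.fromRel (fun x y =>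
    match x, y with
    | some a, some b => (S3g p 2 q).Adj a b
    | none, some (some _) => True
    | _, _ => False)

/-- The inverse `G^I` of a split graph `G` with KS-partition `(A,B)`: delete all edges
inside `A` and add all edges inside `B`. -/
def inverse {V : Type} (G : SimpleGraph V) (A B : Set V) : SimpleGraph V :=
  SimpleGraph.fromRel (fun x y => (G.Adj x y ∧ ¬(x ∈ A ∧ y ∈ A)) ∨ (x ∈ B ∧ y ∈ B))

variable {V : Type}

/-- The degree of a vertex, as it enters `degMultiset`. -/
noncomputable def vdeg (G : SimpleGraph V) (v : V) : ℕ := (G.neighborSet v).ncard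

/-- The adjacency indicator of a graph. -/
noncomputable def ind (G : SimpleGraph V) (u v : V) : ℤ := by
  classical exact if G.Adj u v then 1 else 0

/-- An alternating 4-cycle: `ab`, `cd` are edges and `ad`, `cb` are non-edges. -/
structure AltCycle (G : SimpleGraph V) (a b c d : V) : Prop where
  ab : G.Adj a b
  cd : G.Adj c d
  ad : ¬ G.Adj a d
  cb : ¬ G.Adj c b
  ne_ad : a ≠ d
  ne_cb : c ≠ b

/-- The 2-switch replacing the edges `ab`, `cd` by `ad`, `cb`. -/
def switch (G : SimpleGraph V) (a b c d : V) : SimpleGraph V where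
  Adj u v := u ≠ v ∧
    ((G.Adj u v ∧ ¬ ((u = a ∧ v = b) ∨ (u = b ∧ v = a) ∨ (u = c ∧ v = d) ∨ (u = d ∧ v = c))) ∨
      (u = a ∧ v = d) ∨ (u = d ∧ v = a) ∨ (u = c ∧ v = b) ∨ (u = b ∧ v = c))
  symm := ⟨fun u v h => by have := G.adj_comm u v; tauto⟩
  loopless := ⟨fun u h => h.1 rfl⟩

theorem switch_adj {G : SimpleGraph V} {a b c d u v : V} :
    (switch G a b c d).Adj u v ↔ u ≠ v ∧
    ((G.Adj u v ∧ ¬ ((u = a ∧ v = b) ∨ (u = b ∧ v = a) ∨ (u = c ∧ v = d) ∨ (u = d ∧ v = c))) ∨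
      (u = a ∧ v = d) ∨ (u = d ∧ v = a) ∨ (u = c ∧ v = b) ∨ (u = b ∧ v = c)) := Iff.rfl

namespace AltCycle

variable {G : SimpleGraph V} {a b c d : V}

theorem ne_ac (h : AltCycle G a b c d) : a ≠ c := fun e => h.cb (e ▸ h.ab)

theorem ne_bd (h : AltCycle G a b c d) : b ≠ d := fun e => h.ad (e ▸ h.ab)

theorem swap (h : AltCycle G a b c d) : AltCycle G b a d c :=
  ⟨h.ab.symm, h.cd.symm, fun k => h.cb k.symm, fun k => h.ad k.symm, h.ne_cb.symm, h.ne_ad.symm⟩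

end AltCycle

open Classical in
/-- The signed indicator `e_a - e_c`. -/
noncomputable def sgn (a c u : V) : ℤ := (if u = a then 1 else 0) - (if u = c then 1 else 0)

theorem ind_of_adj {G : SimpleGraph V} {u v : V} (h : G.Adj u v) : ind G u v = 1 := by
  simp [ind, h]

theorem ind_of_not_adj {G : SimpleGraph V} {u v : V} (h : ¬ G.Adj u v) : ind G u v = 0 := by
  simp [ind, h]

theorem ind_congr {W : Type} {G : SimpleGraph V} {H : SimpleGraph W} {u v : V} {u' v' : W}
    (h : G.Adj u v ↔ H.Adj u' v') : ind G u v = ind H u' v' := by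
  by_cases k : G.Adj u v
  · rw [ind_of_adj k, ind_of_adj (h.1 k)]
  · rw [ind_of_not_adj k, ind_of_not_adj (mt h.2 k)]

theorem ind_comm (G : SimpleGraph V) (u v : V) : ind G u v = ind G v u :=
  ind_congr (G.adj_comm u v)

theorem ind_self (G : SimpleGraph V) (u : V) : ind G u u = 0 := ind_of_not_adj (G.irrefl)

theorem AltCycle.ind_switch {G : SimpleGraph V} {a b c d : V} (h : AltCycle G a b c d) (u v : V) :
    ind (switch G a b c d) u v =
      ind G u v - sgn a c u * sgn b d v - sgn b d u * sgn a c v := by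
  have h1 := h.ab
  have h2 := h.cd
  have h3 := h.ad
  have h4 := h.cb
  have h5 := h.ne_ad
  have h6 := h.ne_cb
  have h7 := h.ne_ac
  have h8 := h.ne_bd
  have h9 := h1.ne
  have h10 := h2.ne
  have h11 := G.adj_comm
  have h12 : ∀ x, ¬ G.Adj x x := fun x => G.irrefl
  have h13 := switch_adj (G := G) (a := a) (b := b) (c := c) (d := d) (u := u) (v := v)
  simp only [ind, sgn]
  by_cases ua : u = a
  · subst ua; grind
  by_cases ub : u = b
  · subst ub; grind
  by_cases uc : u = c
  · subst uc; grind
  by_cases ud : u = d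
  · subst ud; grind
  grind

theorem vdeg_iso {W : Type} {G : SimpleGraph V} {H : SimpleGraph W} (φ : G ≃g H) (v : V) :
    vdeg H (φ v) = vdeg G v := by
  have : H.neighborSet (φ v) = φ '' G.neighborSet v := by
    ext w
    obtain ⟨x, rfl⟩ := φ.surjective w
    simp [SimpleGraph.Iso.map_adj_iff]
  rw [vdeg, vdeg, this, Set.ncard_image_of_injective _ φ.injective]

section Invariants

variable [Fintype V]

open Classical in
theorem sum_sgn_mul (a c : V) (F : V → ℤ) : ∑ u, sgn a c u * F u = F a - F c := by
  simp [sgn, sub_mul, Finset.sum_sub_distrib]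

theorem sum_sgn (a c : V) : ∑ u, sgn a c u = 0 := by
  simpa using sum_sgn_mul a c (fun _ => 1)

theorem sum_ind (G : SimpleGraph V) (u : V) : ∑ v, ind G u v = vdeg G u := by
  classical
  simp only [ind, vdeg, Finset.sum_boole]
  rw [Set.ncard_eq_toFinset_card']
  congr 2
  ext v
  simp

theorem AltCycle.vdeg_switch {G : SimpleGraph V} {a b c d : V} (h : AltCycle G a b c d) (v : V) :
    vdeg (switch G a b c d) v = vdeg G v := by
  have : (vdeg (switch G a b c d) v : ℤ) = vdeg G v := by
    rw [← sum_ind, ← sum_ind]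
    simp [h.ind_switch, Finset.sum_sub_distrib, ← Finset.mul_sum, sum_sgn]
  exact_mod_cast this

theorem degMultiset_eq (G : SimpleGraph V) : degMultiset G = Finset.univ.val.map (vdeg G) := rfl

theorem Unigraph.of_vdeg_eq {G H : SimpleGraph V} (hG : Unigraph G)
    (h : ∀ v, vdeg H v = vdeg G v) : Unigraph H := by
  have hm : degMultiset G = degMultiset H := by
    rw [degMultiset_eq, degMultiset_eq, funext h]
  intro W _ K hK
  obtain ⟨φ⟩ := hG V H hm
  obtain ⟨ψ⟩ := hG W K (hm.trans hK)
  exact ⟨φ.symm.trans ψ⟩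

theorem Unigraph.switch {G : SimpleGraph V} (hG : Unigraph G) {a b c d : V}
    (h : AltCycle G a b c d) : Unigraph (switch G a b c d) :=
  hG.of_vdeg_eq h.vdeg_switch

/-- A 2-switch of a unigraph is induced by a degree-preserving permutation of the vertices. -/
theorem Unigraph.exists_perm {G : SimpleGraph V} (hG : Unigraph G) {a b c d : V}
    (h : AltCycle G a b c d) : ∃ φ : V ≃ V, (∀ v, vdeg G (φ v) = vdeg G v) ∧
      ∀ u v, ind (Tysh.switch G a b c d) (φ u) (φ v) = ind G u v := by
  obtain ⟨φ⟩ := hG V (Tysh.switch G a b c d) (by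
    rw [degMultiset_eq, degMultiset_eq, funext h.vdeg_switch])
  refine ⟨φ.toEquiv, fun v => ?_, fun u v => ?_⟩
  · rw [← h.vdeg_switch]; exact vdeg_iso φ v
  · exact ind_congr φ.map_adj_iff

theorem Unigraph.vdeg_eq_or_vdeg_eq {G : SimpleGraph V} (hG : Unigraph G) {a b c d : V}
    (h : AltCycle G a b c d) : vdeg G a = vdeg G c ∨ vdeg G b = vdeg G d := by
  obtain ⟨φ, hφ, hadj⟩ := hG.exists_perm h
  have key : ∑ u, ∑ v, ind (Tysh.switch G a b c d) u v * (vdeg G u * vdeg G v) =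
      ∑ u, ∑ v, ind G u v * (vdeg G u * vdeg G v : ℤ) := by
    rw [← Equiv.sum_comp φ]
    refine Finset.sum_congr rfl fun u _ => ?_
    rw [← Equiv.sum_comp φ]
    exact Finset.sum_congr rfl fun v _ => by rw [hadj, hφ, hφ]
  have e1 : ∀ p q r s : V, ∑ u, ∑ v, sgn p r u * sgn q s v * (vdeg G u * vdeg G v : ℤ) =
      (vdeg G p - vdeg G r) * (vdeg G q - vdeg G s) := by
    intro p q r s
    rw [← sum_sgn_mul p r (fun v => (vdeg G v : ℤ)), ← sum_sgn_mul q s (fun v => (vdeg G v : ℤ)),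
      Finset.sum_mul_sum]
    exact Finset.sum_congr rfl fun u _ => Finset.sum_congr rfl fun v _ => by ring
  simp only [h.ind_switch, sub_mul, Finset.sum_sub_distrib] at key
  rw [e1, e1] at key
  have : (vdeg G a - vdeg G c : ℤ) * (vdeg G b - vdeg G d) = 0 := by linarith
  rcases mul_eq_zero.1 this with h | h <;> [left; right] <;> omega

/-- If `f` separates the degrees of `b` and `d` while `a` and `c` have equal degrees, then a switch
exchanges the `f`-weights of the neighbourhoods of `a` and `c`. -/
theorem Unigraph.sum_sub_sum {G : SimpleGraph V} (hG : Unigraph G) {a b c d : V}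
    (h : AltCycle G a b c d) (hac : vdeg G a = vdeg G c) (f : ℕ → ℤ)
    (hf : f (vdeg G b) ≠ f (vdeg G d)) :
    ∑ v, ind G a v * f (vdeg G v) - ∑ v, ind G c v * f (vdeg G v) =
      f (vdeg G b) - f (vdeg G d) := by
  obtain ⟨φ, hφ, hadj⟩ := hG.exists_perm h
  have key : ∑ u, (∑ v, ind (Tysh.switch G a b c d) u v * f (vdeg G v)) ^ 2 =
      ∑ u, (∑ v, ind G u v * f (vdeg G v)) ^ 2 := by
    rw [← Equiv.sum_comp φ]
    refine Finset.sum_congr rfl fun u _ => ?_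
    rw [← Equiv.sum_comp φ]
    congr 1
    exact Finset.sum_congr rfl fun v _ => by rw [hadj, hφ]
  have e1 : ∀ u, ∑ v, ind (Tysh.switch G a b c d) u v * f (vdeg G v) =
      ∑ v, ind G u v * f (vdeg G v) - sgn a c u * (f (vdeg G b) - f (vdeg G d)) := by
    intro u
    simp only [h.ind_switch, sub_mul, Finset.sum_sub_distrib, mul_assoc, ← Finset.mul_sum,
      sum_sgn_mul, hac]
    ring
  simp only [e1] at key
  set φ := f (vdeg G b) - f (vdeg G d) with hφ
  set S := fun u => ∑ v, ind G u v * f (vdeg G v) with hS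
  have e2 : ∀ u, (S u - sgn a c u * φ) ^ 2 =
      S u ^ 2 - sgn a c u * (2 * φ * S u - φ ^ 2 * sgn a c u) := fun u => by ring
  have e3 : ∑ u, (S u - sgn a c u * φ) ^ 2 = ∑ u, S u ^ 2 := key
  simp only [e2, Finset.sum_sub_distrib, sum_sgn_mul] at e3
  have e4 : sgn a c a = 1 := by simp [sgn, h.ne_ac]
  have e5 : sgn a c c = -1 := by simp [sgn, h.ne_ac.symm]
  rw [e4, e5] at e3
  have e6 : φ * (S a - S c - φ) = 0 := by linarith
  rcases mul_eq_zero.1 e6 with h | h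
  · exact absurd (sub_eq_zero.1 h) hf
  · change S a - S c = φ
    linarith

/-- Invariance of the number of triangles under a 2-switch of a unigraph. -/
theorem Unigraph.sum_mul_eq {G : SimpleGraph V} (hG : Unigraph G) {a b c d : V}
    (h : AltCycle G a b c d) :
    ∑ u, (ind G u a - ind G u c) * (ind G u b - ind G u d) = -2 * (ind G a c + ind G b d) := by
  obtain ⟨φ, -, hadj⟩ := hG.exists_perm h
  set x := ind G with hx
  set α := sgn a c with hα
  set β := sgn b d with hβ
  have key : ∑ u, ∑ v, ∑ w, ind (Tysh.switch G a b c d) u v * ind (Tysh.switch G a b c d) v w *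
      ind (Tysh.switch G a b c d) w u = ∑ u, ∑ v, ∑ w, x u v * x v w * x w u := by
    rw [← Equiv.sum_comp φ]
    refine Finset.sum_congr rfl fun u _ => ?_
    rw [← Equiv.sum_comp φ]
    refine Finset.sum_congr rfl fun v _ => ?_
    rw [← Equiv.sum_comp φ]
    exact Finset.sum_congr rfl fun w _ => by rw [hadj, hadj, hadj]
  have αa : α a = 1 := by simp [hα, sgn, h.ne_ac]
  have αc : α c = -1 := by simp [hα, sgn, h.ne_ac.symm]
  have αb : α b = 0 := by simp [hα, sgn, h.ab.ne', h.ne_cb.symm]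
  have αd : α d = 0 := by simp [hα, sgn, h.ne_ad.symm, h.cd.ne']
  have βb : β b = 1 := by simp [hβ, sgn, h.ne_bd]
  have βd : β d = -1 := by simp [hβ, sgn, h.ne_bd.symm]
  have βa : β a = 0 := by simp [hβ, sgn, h.ab.ne, h.ne_ad]
  have βc : β c = 0 := by simp [hβ, sgn, h.ne_cb, h.cd.ne]
  have hsymm : ∀ u v, x u v = x v u := ind_comm G
  have sα : ∀ F : V → ℤ, ∑ u, α u * F u = F a - F c := sum_sgn_mul a c
  have sβ : ∀ F : V → ℤ, ∑ u, β u * F u = F b - F d := sum_sgn_mul b d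
  have hx' : ∀ u v, ind (Tysh.switch G a b c d) u v = x u v - α u * β v - β u * α v :=
    h.ind_switch
  obtain ⟨A, hA⟩ : ∃ A : V → ℤ, ∀ u, A u = x u a - x u c := ⟨_, fun _ => rfl⟩
  obtain ⟨B, hB⟩ : ∃ B : V → ℤ, ∀ u, B u = x u b - x u d := ⟨_, fun _ => rfl⟩
  obtain ⟨Q, hQ⟩ : ∃ Q : V → V → ℤ, ∀ v u, Q v u = ∑ w, x v w * x w u := ⟨_, fun _ _ => rfl⟩
  have hQ' : ∀ v u, ∑ w, ind (Tysh.switch G a b c d) v w * ind (Tysh.switch G a b c d) w u =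
      Q v u - (α v * B u + β v * A u + A v * β u + B v * α u) +
        2 * (α v * α u) + 2 * (β v * β u) := by
    intro v u
    have : ∀ w, ind (Tysh.switch G a b c d) v w * ind (Tysh.switch G a b c d) w u =
        x v w * x w u - β w * (α v * x w u + x v w * α u - α v * α u * β w - α v * β u * α w
          - β v * α u * α w) - α w * (β v * x w u + x v w * β u - β v * β u * α w) := by
      intro w; rw [hx', hx']; ring
    simp only [this, Finset.sum_sub_distrib, sα, sβ, αa, αb, αc, αd, βb, βd, ← hQ, hA, hB,
      hsymm a u, hsymm b u, hsymm c u, hsymm d u]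
    ring
  have e1 : ∀ H : SimpleGraph V, ∑ u, ∑ v, ∑ w, ind H u v * ind H v w * ind H w u =
      ∑ u, ∑ v, ind H u v * ∑ w, ind H v w * ind H w u := by
    intro H
    simp only [Finset.mul_sum, mul_assoc]
  rw [e1, hx, e1, ← hx] at key
  have e2 : ∀ u, ∑ v, ind (Tysh.switch G a b c d) u v *
      ∑ w, ind (Tysh.switch G a b c d) v w * ind (Tysh.switch G a b c d) w u =
      ∑ v, x u v * Q v u - 2 * (A u * B u) - β u * (∑ v, x u v * A v) - α u * (∑ v, x u v * B v)
        + 2 * (α u * A u) + 2 * (β u * B u)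
        - α u * (Q b u - Q d u - 2 * A u - (B b - B d) * α u - (A b - A d) * β u + 4 * β u)
        - β u * (Q a u - Q c u - 2 * B u - (B a - B c) * α u - (A a - A c) * β u + 4 * α u) := by
    intro u
    have : ∀ v, ind (Tysh.switch G a b c d) u v *
        ∑ w, ind (Tysh.switch G a b c d) v w * ind (Tysh.switch G a b c d) w u =
        x u v * Q v u - α v * (x u v * B u) - β v * (x u v * A u) - β u * (x u v * A v)
          - α u * (x u v * B v) + α v * (2 * α u * x u v) + β v * (2 * β u * x u v)
          - β v * (α u * (Q v u - (α v * B u + β v * A u + A v * β u + B v * α u) +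
        2 * (α v * α u) + 2 * (β v * β u))) - α v * (β u * (Q v u - (α v * B u + β v * A u + A v * β u + B v * α u) +
        2 * (α v * α u) + 2 * (β v * β u))) := by
      intro v; rw [hQ', hx']; ring
    simp only [this, Finset.sum_sub_distrib, Finset.sum_add_distrib, sα, sβ, αa, αb, αc, αd, βa,
      βb, βc, βd, ← Finset.mul_sum]
    rw [hA u, hB u]
    ring
  simp only [e2, Finset.sum_sub_distrib, Finset.sum_add_distrib, sα, sβ, αa, αb, αc, αd, βa,
      βb, βc, βd, ← Finset.mul_sum, ← hQ] at key
  have q : ∀ p r : V, (∑ v, x p v * A v = Q p a - Q p c) ∧ (∑ v, x p v * B v = Q p b - Q p d) := by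
    intro p r
    simp only [hA, hB, hQ, mul_sub, Finset.sum_sub_distrib, and_self]
  have qs : ∀ p r, Q p r = Q r p := by
    intro p r
    rw [hQ, hQ]
    exact Finset.sum_congr rfl fun w _ => by rw [hsymm p w, hsymm w r]; ring
  have hAB : ∑ u, A u * B u = Q a b - Q a d - Q c b + Q c d := by
    simp only [hQ, ← Finset.sum_sub_distrib, ← Finset.sum_add_distrib]
    refine Finset.sum_congr rfl fun u _ => ?_
    rw [hA, hB, hsymm a u, hsymm c u]; ring
  simp only [← hA, ← hB]
  simp only [(q _ a).1, (q _ a).2, qs b, qs d] at key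
  rw [hAB] at key ⊢
  have x0 : ∀ v, x v v = 0 := ind_self G
  simp only [hA, hB, x0] at key
  linarith [hsymm b a, hsymm b c, hsymm b d, hsymm d a, hsymm d c, hsymm c a]

end Invariants

section Basic

variable [Fintype V]

/-- Vertices outside `{v}` adjacent to `u` but not to `v`. -/
def priv (G : SimpleGraph V) (u v : V) : Set V := {x | G.Adj u x ∧ ¬ G.Adj v x ∧ x ≠ v}

theorem vdeg_add_ncard_priv (G : SimpleGraph V) (u v : V) :
    vdeg G u + (priv G v u).ncard = vdeg G v + (priv G u v).ncard := by
  rcases eq_or_ne u v with rfl | huv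
  · rfl
  have e : ∀ p q : V, priv G p q = (G.neighborSet p \ {q}) \ (G.neighborSet q \ {p}) := by
    intro p q
    ext x
    have := G.ne_of_adj (a := p) (b := x)
    simp [priv]
    grind
  have h1 := Set.ncard_sdiff_add_ncard (G.neighborSet u \ {v}) (G.neighborSet v \ {u})
    (Set.toFinite _) (Set.toFinite _)
  have h2 := Set.ncard_sdiff_add_ncard (G.neighborSet v \ {u}) (G.neighborSet u \ {v})
    (Set.toFinite _) (Set.toFinite _)
  rw [← e] at h1 h2
  rw [Set.union_comm] at h2
  simp only [vdeg]
  by_cases h : G.Adj u v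
  · have h3 := Set.ncard_sdiff_singleton_add_one (s := G.neighborSet u) (a := v) h
    have h4 := Set.ncard_sdiff_singleton_add_one (s := G.neighborSet v) (a := u) h.symm
    omega
  · have h3 := Set.sdiff_singleton_eq_self (s := G.neighborSet u) (a := v) h
    have h4 := Set.sdiff_singleton_eq_self (s := G.neighborSet v) (a := u) (fun k => h (G.adj_symm k))
    rw [h3, h4] at h1 h2
    omega

theorem exists_priv_of_lt {G : SimpleGraph V} {u v : V} (h : vdeg G v < vdeg G u) :
    ∃ x, G.Adj u x ∧ ¬ G.Adj v x ∧ x ≠ v := by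
  have := vdeg_add_ncard_priv G u v
  exact (Set.ncard_pos (s := priv G u v)).1 (by omega)

theorem exists_priv_of_le {G : SimpleGraph V} {u v x : V} (h : vdeg G v ≤ vdeg G u)
    (h1 : G.Adj v x) (h2 : ¬ G.Adj u x) (h3 : x ≠ u) :
    ∃ x, G.Adj u x ∧ ¬ G.Adj v x ∧ x ≠ v := by
  have := vdeg_add_ncard_priv G u v
  have h4 : 0 < (priv G v u).ncard := (Set.ncard_pos (s := priv G v u)).2 ⟨x, h1, h2, h3⟩
  exact (Set.ncard_pos (s := priv G u v)).1 (by omega)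

theorem vdeg_compl (G : SimpleGraph V) (v : V) : vdeg Gᶜ v + vdeg G v + 1 = Fintype.card V := by
  have h : Gᶜ.neighborSet v = (insert v (G.neighborSet v))ᶜ := by
    ext x; simp [not_or, eq_comm]
  have h1 := Set.ncard_add_ncard_compl (insert v (G.neighborSet v))
  rw [Set.ncard_insert_of_notMem (by simp), ← h, Nat.card_eq_fintype_card] at h1
  simp only [vdeg]
  omega

theorem Unigraph.compl {G : SimpleGraph V} (hG : Unigraph G) : Unigraph Gᶜ := by
  intro W _ H hH
  have hc : Fintype.card V = Fintype.card W := by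
    simpa [degMultiset] using congrArg Multiset.card hH
  have e : ∀ (U : Type) [Fintype U] (K : SimpleGraph U),
      degMultiset Kᶜ = (degMultiset K).map fun d => Fintype.card U - 1 - d := by
    intro U _ K
    rw [degMultiset_eq, degMultiset_eq, Multiset.map_map]
    refine Multiset.map_congr rfl fun v _ => ?_
    have := vdeg_compl K v
    simp only [Function.comp]
    omega
  have hm : degMultiset G = degMultiset Hᶜ := by
    rw [← compl_compl G, e V, hH, hc, ← e]
  obtain ⟨φ⟩ := hG W Hᶜ hm
  refine ⟨⟨φ.toEquiv, fun {u v} => ?_⟩⟩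
  have := φ.map_adj_iff (v := u) (w := v)
  have h3 := φ.injective.ne_iff (x := u) (y := v)
  have h4 : φ.toEquiv u ≠ φ.toEquiv v ↔ u ≠ v := h3
  have h5 : Hᶜ.Adj (φ.toEquiv u) (φ.toEquiv v) ↔ G.Adj u v := this
  simp only [SimpleGraph.compl_adj] at h5 ⊢
  have h6 := H.ne_of_adj (a := φ.toEquiv u) (b := φ.toEquiv v)
  tauto

/-- If `y` has smaller degree than `x` but a neighbour `z` not adjacent to `x`, then all vertices
distinguishing `x` and `y` have the same degree. -/
theorem Unigraph.vdeg_eq_of_priv {G : SimpleGraph V} (hG : Unigraph G) {x y z w : V}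
    (hlt : vdeg G y < vdeg G x) (zy : G.Adj z y) (zx : ¬ G.Adj z x) (hz : z ≠ x)
    (xw : G.Adj x w) (yw : ¬ G.Adj y w) (hw : w ≠ y) : vdeg G w = vdeg G z := by
  rcases hG.vdeg_eq_or_vdeg_eq (a := x) (b := w) (c := y) (d := z)
    ⟨xw, zy.symm, fun h => zx h.symm, yw, hz.symm, hw.symm⟩ with h | h
  · omega
  · exact h

theorem Unigraph.vdeg_eq_of_priv' {G : SimpleGraph V} (hG : Unigraph G) {x y z w : V}
    (hlt : vdeg G y < vdeg G x) (zy : G.Adj z y) (zx : ¬ G.Adj z x) (hz : z ≠ x)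
    (yw : G.Adj y w) (xw : ¬ G.Adj x w) (hw : w ≠ x) : vdeg G w = vdeg G z := by
  obtain ⟨u, h1, h2, h3⟩ := exists_priv_of_lt hlt
  rw [← hG.vdeg_eq_of_priv hlt zy zx hz h1 h2 h3,
    hG.vdeg_eq_of_priv hlt yw.symm (fun h => xw h.symm) hw h1 h2 h3]

/-- Comparison of the triangle counts before and after a second switch. -/
theorem Unigraph.ind_sub_ind {G : SimpleGraph V} (hG : Unigraph G) {a b c d f g x : V}
    (h1 : AltCycle G a b c d) (h2 : AltCycle G b f x g) (hxa : x ≠ a) (hxc : x ≠ c)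
    (fa : f ≠ a) (fc : f ≠ c) (fd : f ≠ d) (ga : g ≠ a) (gc : g ≠ c) (gd : g ≠ d) :
    ind G f a - ind G f c = ind G g a - ind G g c := by
  have e1 := hG.sum_mul_eq h1
  have hba := h1.ab.ne'
  have hcb := h1.ne_cb
  have hinv : ∀ u v, (v = a ∨ v = c) → ind (Tysh.switch G b f x g) u v = ind G u v := by
    intro u v hv
    rw [h2.ind_switch]
    have s1 : sgn b x v = 0 := by rcases hv with rfl | rfl <;> simp [sgn, *, Ne.symm, h1.ab.ne, hxa.symm, hxc.symm]
    have s2 : sgn f g v = 0 := by rcases hv with rfl | rfl <;> simp [sgn, *, Ne.symm, fa.symm, fc.symm, ga.symm, gc.symm]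
    rw [s1, s2]; ring
  have hadj : ∀ u v, (v = a ∨ v = c) → ((Tysh.switch G b f x g).Adj u v ↔ G.Adj u v) := by
    intro u v hv
    have := hinv u v hv
    by_cases k : G.Adj u v <;> by_cases k' : (Tysh.switch G b f x g).Adj u v <;>
      simp_all [ind]
  have h3 : AltCycle (Tysh.switch G b f x g) a b c d :=
    ⟨((hadj b a (.inl rfl)).2 h1.ab.symm).symm, ((hadj d c (.inr rfl)).2 h1.cd.symm).symm,
      fun k => h1.ad ((hadj d a (.inl rfl)).1 k.symm).symm,
      fun k => h1.cb ((hadj b c (.inr rfl)).1 k.symm).symm, h1.ne_ad, h1.ne_cb⟩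
  have e2 := (hG.switch h2).sum_mul_eq h3
  have sb : sgn b x b = 1 := by simp [sgn, h2.ne_ac]
  have sfb : sgn f g b = 0 := by simp [sgn, h2.ab.ne, h2.ne_ad]
  have sfd : sgn f g d = 0 := by simp [sgn, fd.symm, gd.symm]
  have ebd : ind (Tysh.switch G b f x g) b d = ind G b d := by
    rw [h2.ind_switch, sfd, sfb]; ring
  rw [hinv a c (.inr rfl), ebd, ← e1] at e2
  have e3 : ∀ u, (ind (Tysh.switch G b f x g) u a - ind (Tysh.switch G b f x g) u c) *
      (ind (Tysh.switch G b f x g) u b - ind (Tysh.switch G b f x g) u d) =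
      (ind G u a - ind G u c) * (ind G u b - ind G u d) -
        sgn f g u * ((1 - sgn b x d) * (ind G u a - ind G u c)) := by
    intro u
    rw [hinv u a (.inl rfl), hinv u c (.inr rfl), h2.ind_switch, h2.ind_switch, sb, sfb, sfd]
    ring
  simp only [e3, Finset.sum_sub_distrib, sum_sgn_mul] at e2
  have e4 : (1 - sgn b x d) ≠ 0 := by
    by_cases hdx : d = x
    · simp [sgn, hdx, h2.ne_ac.symm]
    · simp [sgn, h1.ne_bd.symm, hdx]
  have e5 : (1 - sgn b x d) * ((ind G f a - ind G f c) - (ind G g a - ind G g c)) = 0 := by linarith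
  have := (mul_eq_zero.1 e5).resolve_left e4
  linarith

end Basic

section HighLow

variable [Fintype V]

/-- Two nonadjacent vertices whose degrees exceed those of the ends of an edge. -/
structure Obstruction (G : SimpleGraph V) (u u' v v' : V) : Prop where
  nadj : ¬ G.Adj u u'
  ne : u ≠ u'
  adj : G.Adj v v'
  uv : vdeg G v < vdeg G u
  uv' : vdeg G v' < vdeg G u
  u'v : vdeg G v < vdeg G u'
  u'v' : vdeg G v' < vdeg G u'

namespace Obstruction

variable {G : SimpleGraph V} {u u' v v' : V}

theorem swap_left (h : Obstruction G u u' v v') : Obstruction G u' u v v' :=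
  ⟨fun k => h.nadj k.symm, h.ne.symm, h.adj, h.u'v, h.u'v', h.uv, h.uv'⟩

theorem swap_right (h : Obstruction G u u' v v') : Obstruction G u u' v' v :=
  ⟨h.nadj, h.ne, h.adj.symm, h.uv', h.uv, h.u'v', h.u'v⟩

theorem compl (h : Obstruction G u u' v v') : Obstruction Gᶜ v v' u u' := by
  have h1 := vdeg_compl G u
  have h2 := vdeg_compl G u'
  have h3 := vdeg_compl G v
  have h4 := vdeg_compl G v'
  obtain ⟨a1, a2, a3, a4, a5, a6, a7⟩ := h
  refine ⟨fun k => k.2 a3, a3.ne, ⟨a2, a1⟩, ?_, ?_, ?_, ?_⟩ <;> omega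

theorem adj_of_adj (hG : Unigraph G) (h : Obstruction G u u' v v') (k : G.Adj u v) :
    G.Adj u' v' := by
  by_contra hn
  have hne : v' ≠ u' := fun e => by have := h.u'v'; rw [e] at this; omega
  have := hG.vdeg_eq_of_priv' h.u'v k h.nadj h.ne h.adj hn hne
  have := h.uv'
  omega

theorem false_of_matching (hG : Unigraph G) (h : Obstruction G u u' v v') (k : G.Adj u v)
    (k' : G.Adj u' v') (n : ¬ G.Adj u v') (n' : ¬ G.Adj u' v) : False := by
  have aux : ∀ {u u' v v' : V}, Obstruction G u u' v v' → G.Adj u v → G.Adj u' v' →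
      ¬ G.Adj u v' → ¬ G.Adj u' v → ∃ p, G.Adj u p ∧ ¬ G.Adj v' p ∧ p ≠ v' ∧
        vdeg G p = vdeg G u' ∧ G.Adj p v ∧ ¬ G.Adj p u' ∧ p ≠ u' := by
    intro u u' v v' h k k' n n'
    obtain ⟨p, h1, h2, h3⟩ := exists_priv_of_lt h.uv'
    have hp := hG.vdeg_eq_of_priv h.uv' k' (fun e => h.nadj e.symm) h.ne.symm h1 h2 h3
    have h4 : G.Adj p v := by
      by_contra hn
      have hpv : p ≠ v := fun e => h2 (e ▸ h.adj.symm)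
      have := hG.vdeg_eq_of_priv h.uv h.adj.symm (fun e => n e.symm)
        (fun e => by have := h.uv'; rw [e] at this; omega) h1 (fun e => hn e.symm) hpv
      have := h.u'v'
      omega
    refine ⟨p, h1, h2, h3, hp, h4, fun hn => ?_, fun e => h.nadj (e ▸ h1)⟩
    have := hG.vdeg_eq_of_priv h.u'v' h.adj (fun e => n' e.symm)
        (fun e => by have := h.u'v; rw [e] at this; omega) hn.symm h2 h3
    have := h.u'v
    omega
  obtain ⟨p, h1, h2, h3, h4, h5, h6, h7⟩ := aux h k k' n n'
  obtain ⟨q, q1, q2, q3, q4, q5, q6, q7⟩ := aux h.swap_left.swap_right k' k n' n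
  have c1 : AltCycle G u v u' v' := ⟨k, k', n, n', fun e => by
    have := h.uv'; rw [e] at this; omega, fun e => by have := h.u'v; rw [e] at this; omega⟩
  have c2 : AltCycle G v p v' q := ⟨h5.symm, q5.symm, q2, h2, q3.symm, h3.symm⟩
  have hpv : p ≠ v := h5.ne
  have hqv' : q ≠ v' := q5.ne
  by_cases e : vdeg G u = vdeg G u'
  · have := hG.ind_sub_ind c1 c2 (fun e => c1.ne_ad e.symm) k'.ne' h1.ne' h7 h3 q7 q1.ne' hqv'
    rw [ind_of_adj h1.symm, ind_of_adj q1.symm, ind_of_not_adj h6, ind_of_not_adj q6] at this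
    norm_num at this
  · have f1 := (hG.vdeg_eq_or_vdeg_eq c1).resolve_left e
    have f2 := hG.sum_sub_sum c1.swap f1 (fun n => (n : ℤ)) (by simpa using e)
    have f3 := hG.sum_sub_sum c2 f1 (fun n => (n : ℤ)) (by simp [h4, q4]; omega)
    have : (vdeg G u : ℤ) = vdeg G u' := by
      simp only [h4, q4] at f3
      linarith
    omega

theorem false_of_complete (hG : Unigraph G) (h : Obstruction G u u' v v') (k1 : G.Adj u v)
    (k2 : G.Adj u v') (k3 : G.Adj u' v) (k4 : G.Adj u' v') : False := by
  have aux : ∀ {v v' : V}, Obstruction G u u' v v' → G.Adj u v → G.Adj u v' → G.Adj u' v →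
      G.Adj u' v' → ∃ x, G.Adj u' x ∧ ¬ G.Adj v x ∧ x ≠ v ∧ vdeg G x = vdeg G u ∧
      vdeg G x = vdeg G u' ∧ G.Adj x v' := by
    intro v v' h k1 k2 k3 k4
    obtain ⟨x, h1, h2, h3⟩ := exists_priv_of_lt h.u'v
    have hx := hG.vdeg_eq_of_priv h.u'v k1 h.nadj h.ne h1 h2 h3
    have hxu : x ≠ u := fun e => h2 (e ▸ k1.symm)
    have h4 : G.Adj u x := by
      by_contra hn
      have ho : Obstruction G u x v v' :=
        ⟨hn, hxu.symm, h.adj, h.uv, h.uv', hx ▸ h.uv, hx ▸ h.uv'⟩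
      exact h2 (ho.swap_right.adj_of_adj hG k2).symm
    have hx' := hG.vdeg_eq_of_priv h.uv k3 (fun e => h.nadj e.symm) h.ne.symm h4 h2 h3
    refine ⟨x, h1, h2, h3, hx, hx', ?_⟩
    by_contra hn
    have hc : AltCycle G u v x u' := ⟨k1, h1.symm, h.nadj, fun e => h2 e.symm, h.ne, h3⟩
    have hne : ∀ p q : V, vdeg G p < vdeg G q → p ≠ q := fun p q h e => by
      rw [e] at h; omega
    have n1 := hne _ _ h.uv
    have n2 := hne _ _ h.u'v
    have n3 := hne _ _ h.uv'
    have n4 := hne _ _ h.u'v'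
    have n5 : v' ≠ x := hne _ _ (hx ▸ h.uv')
    have hk : Obstruction (switch G u v x u') u' x v v' := by
      refine ⟨?_, h1.ne, ?_, ?_, ?_, ?_, ?_⟩
      · have := h.ne; have := h1.ne; have := h4.ne
        rw [switch_adj]; grind
      · have := h.adj.ne; have := h.adj
        rw [switch_adj]; grind
      all_goals
        rw [hc.vdeg_switch, hc.vdeg_switch]
        first | exact h.u'v | exact h.u'v' | (rw [hx]; exact h.uv) | (rw [hx]; exact h.uv')
    have h5 : (switch G u v x u').Adj u' v := by
      have := h.ne; have := h1.ne; have := h4.ne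
      rw [switch_adj]; grind
    have h6 := hk.adj_of_adj (hG.switch hc) h5
    rw [switch_adj] at h6
    have := h.adj.ne
    grind
  obtain ⟨x, x1, x2, x3, x4, x5, x6⟩ := aux h k1 k2 k3 k4
  obtain ⟨y, y1, y2, y3, y4, y5, y6⟩ := aux h.swap_right k2 k1 k4 k3
  have hxy : x ≠ y := fun e => y2 (e ▸ x6.symm)
  have hxv : vdeg G v' < vdeg G x := x4 ▸ h.uv'
  have hyv : vdeg G v < vdeg G y := y4 ▸ h.uv
  by_cases k : G.Adj x y
  · rcases hG.vdeg_eq_or_vdeg_eq (a := x) (b := y) (c := v') (d := v)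
      ⟨k, h.adj.symm, fun e => x2 e.symm, y2, x3, y3.symm⟩ with e | e <;> omega
  · refine false_of_matching hG (u := x) (u' := y) (v := v') (v' := v) ⟨k, hxy, h.adj.symm, hxv, ?_, ?_, hyv⟩ x6 y6
      (fun e => x2 e.symm) (fun e => y2 e.symm)
    · rw [x4]; exact h.uv
    · rw [y4]; exact h.uv'

theorem elim (hG : Unigraph G) (h : Obstruction G u u' v v') : False := by
  have h1 : G.Adj u v ↔ G.Adj u' v' :=
    ⟨h.adj_of_adj hG, h.swap_left.swap_right.adj_of_adj hG⟩
  have h2 : G.Adj u v' ↔ G.Adj u' v :=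
    ⟨h.swap_right.adj_of_adj hG, h.swap_left.adj_of_adj hG⟩
  have hne : ∀ p q : V, vdeg G p < vdeg G q → q ≠ p := fun p q h e => by
    rw [e] at h; omega
  by_cases k1 : G.Adj u v <;> by_cases k2 : G.Adj u v'
  · exact h.false_of_complete hG k1 k2 (h2.1 k2) (h1.1 k1)
  · exact h.false_of_matching hG k1 (h1.1 k1) k2 (mt h2.2 k2)
  · exact h.swap_right.false_of_matching hG k2 (h2.1 k2) k1 (mt h1.2 k1)
  · exact h.compl.false_of_complete hG.compl ⟨(hne _ _ h.uv).symm, fun e => k1 e.symm⟩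
      ⟨(hne _ _ h.u'v).symm, fun e => k2 (h2.2 e.symm)⟩
      ⟨(hne _ _ h.uv').symm, fun e => k2 e.symm⟩
      ⟨(hne _ _ h.u'v').symm, fun e => k1 (h1.2 e.symm)⟩

end Obstruction

end HighLow

section LayerAnalysis

variable [Fintype V]

/-- The vertices of degree `> k` form a clique, those of degree `< k` are independent, and neither
property extends to the vertices of degree `k`. -/
structure Layers (G : SimpleGraph V) (k : ℕ) : Prop where
  clique : ∀ u v, k < vdeg G u → k < vdeg G v → u ≠ v → G.Adj u v
  indep : ∀ u v, vdeg G u < k → vdeg G v < k → ¬ G.Adj u v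
  low : ∃ x y, G.Adj x y ∧ vdeg G x ≤ k ∧ vdeg G y ≤ k
  high : ∃ x y, ¬ G.Adj x y ∧ x ≠ y ∧ k ≤ vdeg G x ∧ k ≤ vdeg G y

theorem vdeg_lt_card (G : SimpleGraph V) (v : V) : vdeg G v < Fintype.card V := by
  have := vdeg_compl G v
  omega

theorem Unigraph.exists_layers {G : SimpleGraph V} (hG : Unigraph G) (hs : ¬ IsSplit G) :
    ∃ k, Layers G k := by
  classical
  have h0 : ∃ x y, ¬ G.Adj x y ∧ x ≠ y ∧ 0 ≤ vdeg G x ∧ 0 ≤ vdeg G y := by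
    by_contra! h
    refine hs ⟨Set.univ, ∅, fun x _ y _ hxy => ?_, fun x hx => hx.elim, by simp, by simp⟩
    by_contra hn
    exact absurd (h x y hn hxy (Nat.zero_le _)) (by omega)
  have hb : ∀ k, (∃ x y, ¬ G.Adj x y ∧ x ≠ y ∧ k ≤ vdeg G x ∧ k ≤ vdeg G y) →
      k ≤ Fintype.card V := fun k ⟨x, _, _, _, h, _⟩ => h.trans (vdeg_lt_card G x).le
  let k := Nat.findGreatest (fun k => ∃ x y, ¬ G.Adj x y ∧ x ≠ y ∧ k ≤ vdeg G x ∧ k ≤ vdeg G y)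
    (Fintype.card V)
  have hk : ∃ x y, ¬ G.Adj x y ∧ x ≠ y ∧ k ≤ vdeg G x ∧ k ≤ vdeg G y :=
    Nat.findGreatest_spec (P := fun k => ∃ x y, ¬ G.Adj x y ∧ x ≠ y ∧ k ≤ vdeg G x ∧ k ≤ vdeg G y)
      (Nat.zero_le _) h0
  have hc : ∀ u v, k < vdeg G u → k < vdeg G v → u ≠ v → G.Adj u v := by
    intro u v hu hv huv
    by_contra hn
    have h1 : ∃ x y, ¬ G.Adj x y ∧ x ≠ y ∧ k + 1 ≤ vdeg G x ∧ k + 1 ≤ vdeg G y :=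
      ⟨u, v, hn, huv, hu, hv⟩
    have : k + 1 ≤ k := Nat.le_findGreatest (hb _ h1) h1
    omega
  refine ⟨k, hc, fun u v hu hv huv => ?_, ?_, hk⟩
  · obtain ⟨x, y, h1, h2, h3, h4⟩ := hk
    exact Obstruction.elim hG ⟨h1, h2, huv, by omega, by omega, by omega, by omega⟩
  · by_contra! h
    refine hs ⟨{v | k < vdeg G v}, {v | vdeg G v ≤ k}, fun x hx y hy hxy => hc x y hx hy hxy,
      fun x hx y hy _ hadj => ?_, ?_, ?_⟩
    · have := h x y hadj hx
      simp only [Set.mem_ofPred_eq] at hy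
      omega
    · ext v; simp; omega
    · rw [Set.disjoint_left]; intro v; simp

namespace Layers

variable {G : SimpleGraph V} {k : ℕ}

theorem compl (h : Layers G k) : Layers Gᶜ (Fintype.card V - 1 - k) := by
  have hd := vdeg_compl G
  obtain ⟨x, y, h1, h2, h3, h4⟩ := h.high
  obtain ⟨x', y', h1', h2', h3'⟩ := h.low
  refine ⟨fun u v hu hv huv => ⟨huv, h.indep u v ?_ ?_⟩,
    fun u v hu hv huv => huv.2 (h.clique u v ?_ ?_ huv.1),
    ⟨x, y, ⟨h2, h1⟩, ?_, ?_⟩, ⟨x', y', fun hn => hn.2 h1', h1'.ne, ?_, ?_⟩⟩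
  · have := hd u; omega
  · have := hd v; omega
  · have := hd u; have := hd x; omega
  · have := hd v; have := hd x; omega
  · have := hd x; omega
  · have := hd y; omega
  · have := hd x'; omega
  · have := hd y'; omega

theorem not_adj_of_triangle (hG : Unigraph G) (h : Layers G k) {a b c : V} (ha : k < vdeg G a)
    (hc : vdeg G c = k) (hb : vdeg G b < k) (ab : G.Adj a b) (ac : ¬ G.Adj a c) :
    ¬ G.Adj b c := by
  intro bc
  obtain ⟨p, p1, p2, p3⟩ := exists_priv_of_lt (G := G) (u := c) (v := b) (by omega)
  have hac : a ≠ c := fun e => by rw [e] at ha; omega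
  have hp := hG.vdeg_eq_of_priv (by omega) ab ac hac p1 p2 p3
  have hpa : p ≠ a := fun e => ac (e ▸ p1.symm)
  have := h.clique a p ha (by omega) hpa.symm
  rcases hG.vdeg_eq_or_vdeg_eq (a := b) (b := c) (c := a) (d := p)
    ⟨bc, this, p2, ac, p3.symm, hac⟩ with e | e <;> omega

theorem not_adj_of_adj (hG : Unigraph G) (h : Layers G k) {a b c c' : V} (ha : k < vdeg G a)
    (hc : vdeg G c = k) (hc' : vdeg G c' = k) (hb : vdeg G b < k) (ab : G.Adj a b)
    (ac : ¬ G.Adj a c) : ¬ G.Adj b c' := by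
  intro bc'
  have hcb : ¬ G.Adj b c := h.not_adj_of_triangle hG ha hc hb ab ac
  have hcc' : c ≠ c' := fun e => hcb (e ▸ bc')
  have hac : a ≠ c := fun e => by rw [e] at ha; omega
  have hcc : G.Adj c' c := by
    by_contra hn
    have := hG.vdeg_eq_of_priv' (x := c) (y := b) (z := a) (w := c') (by omega) ab ac hac bc'
      (fun e => hn e.symm) hcc'.symm
    omega
  have hac' : G.Adj a c' := by
    by_contra hn
    exact h.not_adj_of_triangle hG ha hc' hb ab hn bc'
  have key : ∀ y, G.Adj c y → ¬ G.Adj b y → y ≠ b → G.Adj y c' := by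
    intro y h1 h2 h3
    by_contra hn
    have hy := hG.vdeg_eq_of_priv (by omega) ab ac hac h1 h2 h3
    have hya : y ≠ a := fun e => ac (e ▸ h1.symm)
    have := h.clique a y ha (by omega) hya.symm
    rcases hG.vdeg_eq_or_vdeg_eq (a := c') (b := c) (c := a) (d := y)
      ⟨hcc, this, fun e => hn e.symm, ac, fun e => h2 (e ▸ bc'), hac⟩ with e | e <;> omega
  obtain ⟨y, y1, y2, y3⟩ := exists_priv_of_le (G := G) (u := c) (v := c') (by omega) bc'.symm
    (fun e => hcb e.symm) (fun e => by rw [e] at hb; omega)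
  have yb : G.Adj b y := by
    by_contra hn
    exact y2 (key y y1 hn (fun e => hcb (e ▸ y1.symm))).symm
  have hy : k ≤ vdeg G y := by
    by_contra hn
    exact h.indep b y hb (by omega) yb
  have cbne : c ≠ b := fun e => by rw [e] at hc; omega
  have f1 := hG.sum_sub_sum (a := c') (b := b) (c := c) (d := y)
    ⟨bc'.symm, y1, y2, fun e => hcb e.symm, y3.symm, cbne⟩ (by omega) (fun n => (n : ℤ))
    (by simp; omega)
  by_cases e : vdeg G y = vdeg G a
  · exact h.not_adj_of_triangle hG (by omega) hc' hb yb.symm (fun e => y2 e.symm) bc'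
  · have f2 := hG.sum_sub_sum (a := c) (b := y) (c := c') (d := a)
      ⟨y1, hac'.symm, fun e => ac e.symm, y2, hac.symm, y3.symm⟩ (by omega) (fun n => (n : ℤ))
      (by simpa using e)
    omega

/-- A vertex of high degree with a non-neighbour in the middle layer excludes edges between the low
and the middle layer. -/
theorem not_adj (hG : Unigraph G) (h : Layers G k) {a b c c' : V} (ha : k < vdeg G a)
    (hc : vdeg G c = k) (hc' : vdeg G c' = k) (hb : vdeg G b < k) (ac : ¬ G.Adj a c) :
    ¬ G.Adj b c' := by
  intro bc'
  by_cases ab : G.Adj a b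
  · exact h.not_adj_of_adj hG ha hc hc' hb ab ac bc'
  · have hd := vdeg_compl G
    have d1 := hd a; have d2 := hd b; have d3 := hd c; have d4 := hd c'
    refine h.compl.not_adj_of_adj hG.compl (a := b) (b := a) (c := c') (c' := c)
      (by omega) (by omega) (by omega) (by omega) ⟨fun e => ?_, fun e => ab e.symm⟩
      (fun e => e.2 bc') ⟨fun e => ?_, ac⟩
    · rw [e] at hb; omega
    · rw [e] at ha; omega

theorem not_adj_low (hG : Unigraph G) {a b c x y : V}
    (hBC : ∀ b c, vdeg G b < k → vdeg G c = k → ¬ G.Adj b c) (xy : G.Adj x y)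
    (hx : vdeg G x = k) (hy : vdeg G y = k) (ha : k < vdeg G a)
    (hc : vdeg G c = k) (hb : vdeg G b < k) (ac : ¬ G.Adj a c) : ¬ G.Adj a b := by
  intro ab
  have key : ∀ {H : SimpleGraph V}, Unigraph H → (∀ v, vdeg H v = vdeg G v) → ∀ {a x y},
      k < vdeg G a → vdeg G x = k → vdeg G y = k → H.Adj a b → ¬ H.Adj a x → H.Adj x y →
      ¬ H.Adj b y → False := by
    intro H hH hd a x y ha hx hy ab ax xy yb
    have := hH.vdeg_eq_of_priv (x := x) (y := b) (z := a) (w := y) (by rw [hd, hd]; omega) ab ax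
      (fun e => by rw [e] at ha; omega) xy yb (fun e => by rw [e] at hy; omega)
    rw [hd, hd] at this
    omega
  have hcC : ∀ y, vdeg G y = k → ¬ G.Adj c y := fun y hy cy =>
    key hG (fun _ => rfl) ha hc hy ab ac cy (hBC b y hb hy)
  have hcx : ¬ G.Adj c x := hcC x hx
  obtain ⟨p, p1, p2, p3⟩ := exists_priv_of_le (G := G) (u := c) (v := x) (by omega) xy
    (hcC y hy) (fun e => hcx (e ▸ xy.symm))
  have hp : k < vdeg G p := by
    by_contra hn
    rcases (not_lt.1 hn).lt_or_eq with e | e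
    · exact hBC p c e hc p1.symm
    · exact hcC p e p1
  by_cases pb : G.Adj p b
  · exact key hG (fun _ => rfl) hp hx hy pb (fun e => p2 e.symm) xy (hBC b y hb hy)
  · have hne : ∀ u v : V, vdeg G u ≠ vdeg G v → u ≠ v := fun u v h e => h (e ▸ rfl)
    have n1 : a ≠ c := hne _ _ (by omega)
    have n2 : p ≠ b := hne _ _ (by omega)
    have n3 : x ≠ b := hne _ _ (by omega)
    have n4 : y ≠ b := hne _ _ (by omega)
    have n5 : y ≠ a := hne _ _ (by omega)
    have n6 : y ≠ p := hne _ _ (by omega)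
    have n7 : x ≠ a := hne _ _ (by omega)
    have n8 : y ≠ c := fun e => hcx (e ▸ xy.symm)
    have n9 : x ≠ c := fun e => hcC y hy (e ▸ xy)
    have n10 : p ≠ a := fun e => ac (e ▸ p1.symm)
    have hs : AltCycle G a b p c := ⟨ab, p1.symm, ac, pb, n1, n2⟩
    refine key (hG.switch hs) hs.vdeg_switch hp hx hy ?_ ?_ (y := y) ?_ ?_
    · rw [switch_adj]; grind
    · have := G.adj_comm p x
      rw [switch_adj]; grind
    · rw [switch_adj]; have := xy.ne; grind
    · have := hBC b y hb hy
      rw [switch_adj]; grind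

/-- In the indecomposable case there are no low vertices, and every high vertex has a non-neighbour
in the middle layer. -/
theorem le_vdeg (hG : Unigraph G) (hD : ¬ Decomposable G) (h : Layers G k)
    (hBC : ∀ b c, vdeg G b < k → vdeg G c = k → ¬ G.Adj b c) {x y : V} (xy : G.Adj x y)
    (hx : vdeg G x = k) (hy : vdeg G y = k) :
    (∀ v, k ≤ vdeg G v) ∧ ∀ a, k < vdeg G a → ∃ c, vdeg G c = k ∧ ¬ G.Adj a c := by
  by_contra hn
  refine hD ⟨{a | k < vdeg G a ∧ ∀ c, vdeg G c = k → G.Adj a c}, {b | vdeg G b < k},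
    {v | k ≤ vdeg G v ∧ (k < vdeg G v → ∃ c, vdeg G c = k ∧ ¬ G.Adj v c)}, ?_, ?_, ?_, ?_,
    ⟨x, hx.ge, fun e => by omega⟩, fun u hu v hv huv => h.clique u v hu.1 hv.1 huv,
    fun u hu v hv _ => h.indep u v hu hv, ?_, ?_⟩
  · ext v
    simp only [Set.mem_union, Set.mem_ofPred_eq, Set.mem_univ, iff_true]
    by_cases h1 : vdeg G v < k
    · exact .inl (.inr h1)
    · by_cases h2 : ∀ c, vdeg G c = k → G.Adj v c
      · by_cases h3 : k < vdeg G v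
        · exact .inl (.inl ⟨h3, h2⟩)
        · exact .inr ⟨by omega, fun e => absurd e h3⟩
      · push Not at h2
        exact .inr ⟨by omega, fun _ => h2⟩
  · rw [Set.disjoint_left]
    rintro v ⟨h1, _⟩ h2
    exact absurd h1 (not_lt.2 (le_of_lt h2))
  · rw [Set.disjoint_left]
    rintro v (⟨h1, h2⟩ | h1) ⟨h3, h4⟩
    · obtain ⟨c, c1, c2⟩ := h4 h1
      exact c2 (h2 c c1)
    · exact absurd h3 (not_le.2 h1)
  · by_contra he
    rw [Set.not_nonempty_iff_eq_empty] at he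
    have he' := fun v => Set.eq_empty_iff_forall_notMem.1 he v
    refine hn ⟨fun v => ?_, fun a ha => ?_⟩
    · by_contra hv
      exact he' v (.inr (not_le.1 hv))
    · by_contra! hv
      exact he' a (.inl ⟨ha, hv⟩)
  · rintro a ⟨ha, ha'⟩ w ⟨hw, hw'⟩
    by_cases e : vdeg G w = k
    · exact ha' w e
    · refine h.clique a w ha (by omega) fun e' => ?_
      obtain ⟨c, c1, c2⟩ := hw' (by omega)
      exact c2 (e' ▸ ha' c c1)
  · rintro b hb w ⟨hw, hw'⟩ bw
    by_cases e : vdeg G w = k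
    · exact hBC b w hb e bw
    · obtain ⟨c, c1, c2⟩ := hw' (by omega)
      exact not_adj_low hG hBC xy hx hy (by omega) c1 hb c2 bw.symm

theorem adj_of_not_adj {H : SimpleGraph V} (hH : Unigraph H) {a a' x y : V} (xy : H.Adj x y)
    (aa : H.Adj a a') (hx : vdeg H x ≤ k) (hy : vdeg H y ≤ k) (ha : k < vdeg H a)
    (ha' : k < vdeg H a') (ax : ¬ H.Adj a x) : H.Adj a' y := by
  by_contra hn
  rcases hH.vdeg_eq_or_vdeg_eq (a := y) (b := x) (c := a) (d := a')
    ⟨xy.symm, aa, fun e => hn e.symm, ax, fun e => by rw [e] at hy; omega,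
      fun e => by rw [e] at ha; omega⟩ with e | e <;> omega

theorem ncard_high (hG : Unigraph G) {a b c d : V} (h : AltCycle G a b c d)
    (hac : vdeg G a = vdeg G c) (hb : k < vdeg G b) (hd : vdeg G d ≤ k) :
    {v | G.Adj a v ∧ k < vdeg G v}.ncard = {v | G.Adj c v ∧ k < vdeg G v}.ncard + 1 := by
  classical
  have e : ∀ u, ∑ v, ind G u v * (if k < vdeg G v then 1 else 0) =
      ({v | G.Adj u v ∧ k < vdeg G v}.ncard : ℤ) := by
    intro u
    rw [Set.ncard_eq_toFinset_card', Finset.card_eq_sum_ones, ← Finset.sum_filter_add_sum_filter_not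
      Finset.univ (fun v => G.Adj u v ∧ k < vdeg G v)]
    rw [Finset.sum_eq_zero (s := Finset.univ.filter fun v => ¬ (G.Adj u v ∧ k < vdeg G v))]
    · push_cast
      rw [add_zero]
      refine Finset.sum_congr (by ext; simp) fun v hv => ?_
      simp at hv
      simp [ind, hv]
    · intro v hv
      simp at hv
      by_cases h1 : G.Adj u v <;> simp [ind, h1]
      exact hv h1
  have := hG.sum_sub_sum h hac (fun n => if k < n then 1 else 0) (by simp [hb]; omega)
  simp only [e, hb, if_true, not_lt.2 hd, if_false] at this
  omega

theorem high_unique (hG : Unigraph G) (h : Layers G k) (hB : ∀ v, k ≤ vdeg G v)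
    (hA : ∀ a, k < vdeg G a → ∃ c, vdeg G c = k ∧ ¬ G.Adj a c) {x y : V} (xy : G.Adj x y)
    (hx : vdeg G x = k) (hy : vdeg G y = k) {a₁ a₂ : V} (ha₁ : k < vdeg G a₁) (ha₂ : k < vdeg G a₂) :
    a₁ = a₂ := by
  by_contra haa
  have hC : ∀ v, ¬ k < vdeg G v → vdeg G v = k := fun v hv => by have := hB v; omega
  have c4 : ∀ {x y a a'}, G.Adj x y → vdeg G x = k → vdeg G y = k → k < vdeg G a →
      k < vdeg G a' → a ≠ a' → ¬ G.Adj a x → G.Adj a' y := fun xy hx hy ha ha' haa ax =>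
    adj_of_not_adj hG xy (h.clique _ _ ha ha' haa) hx.le hy.le ha ha' ax
  have hN : ∀ {x y a a'}, G.Adj x y → vdeg G x = k → vdeg G y = k → k < vdeg G a →
      k < vdeg G a' → a' ≠ a → G.Adj a y → ¬ G.Adj a x → G.Adj a' x := by
    intro x y a a' xy hx hy ha ha' haa ay ax
    by_contra hn
    obtain ⟨z, z1, z2, z3⟩ := exists_priv_of_le (G := G) (u := x) (v := y) (by omega) ay.symm
      (fun e => ax e.symm) (fun e => by rw [e] at ha; omega)
    have hz : ¬ k < vdeg G z := fun hz =>
      z2 (c4 xy hx hy ha hz (fun e => ax (e ▸ z1.symm)) ax).symm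
    have := ncard_high (k := k) hG (a := y) (b := a) (c := x) (d := z)
      ⟨ay.symm, z1, z2, fun e => ax e.symm, z3.symm, fun e => by rw [e] at hx; omega⟩ (by omega) ha
      (by omega)
    have hsub : insert a (insert a' {v | G.Adj x v ∧ k < vdeg G v}) ⊆
        {v | G.Adj y v ∧ k < vdeg G v} := by
      rintro v (rfl | rfl | ⟨h1, h2⟩)
      · exact ⟨ay.symm, ha⟩
      · exact ⟨(c4 xy hx hy ha ha' haa.symm ax).symm, ha'⟩
      · exact ⟨(c4 xy hx hy ha h2 (fun e => ax (e ▸ h1.symm)) ax).symm, h2⟩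
    have h2 := Set.ncard_le_ncard hsub
    rw [Set.ncard_insert_of_notMem, Set.ncard_insert_of_notMem] at h2
    · omega
    · exact fun e => hn e.1.symm
    · rintro (e | e)
      · exact haa e.symm
      · exact ax e.1.symm
  by_cases hcase : ∃ x y a, G.Adj x y ∧ vdeg G x = k ∧ vdeg G y = k ∧ k < vdeg G a ∧
      ¬ G.Adj a x ∧ ¬ G.Adj a y
  · obtain ⟨x, y, a, xy, hx, hy, ha, ax, ay⟩ := hcase
    obtain ⟨a', ha', haa⟩ : ∃ a', k < vdeg G a' ∧ a ≠ a' := by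
      by_cases e : a = a₁
      · exact ⟨a₂, ha₂, fun e' => haa (e.symm.trans e')⟩
      · exact ⟨a₁, ha₁, e⟩
    obtain ⟨c, hc, ca'⟩ := hA a' ha'
    have cx : ¬ G.Adj c x := fun e => ca' (c4 e.symm hx hc ha ha' haa ax)
    have cy : ¬ G.Adj c y := fun e => ca' (c4 e.symm hy hc ha ha' haa ay)
    have a'x : G.Adj a' x := c4 xy.symm hy hx ha ha' haa ay
    have a'y : G.Adj a' y := c4 xy hx hy ha ha' haa ax
    have hcx : c ≠ x := fun e => ca' (e ▸ a'x)
    have hya : y ≠ a := fun e => by rw [e] at hy; omega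
    by_cases ca : G.Adj c a
    · have := ncard_high (k := k) hG (a := c) (b := a) (c := y) (d := x)
        ⟨ca, xy.symm, cx, fun e => ay e.symm, hcx, hya⟩ (by omega) ha (by omega)
      have h1 : {v | G.Adj c v ∧ k < vdeg G v} ⊆ {v | k < vdeg G v} \ {a'} :=
        fun v hv => ⟨hv.2, fun e => ca' (by rw [← Set.mem_singleton_iff.1 e]; exact hv.1.symm)⟩
      have h2 : {v | k < vdeg G v} \ {a} ⊆ {v | G.Adj y v ∧ k < vdeg G v} :=
        fun v hv => ⟨(c4 xy hx hy ha hv.1 (fun e => hv.2 e.symm) ax).symm, hv.1⟩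
      have h3 := Set.ncard_le_ncard h1
      have h4 := Set.ncard_le_ncard h2
      have h5 := Set.ncard_sdiff_singleton_add_one (s := {v | k < vdeg G v}) (a := a) ha
      have h6 := Set.ncard_sdiff_singleton_add_one (s := {v | k < vdeg G v}) (a := a') ha'
      omega
    · obtain ⟨w, w1, w2, w3⟩ := exists_priv_of_le (G := G) (u := c) (v := x) (by omega) a'x.symm
        (fun e => ca' e.symm) (fun e => by rw [e] at ha'; omega)
      have hw := hC w fun hw =>
        w2 (c4 xy.symm hy hx ha hw (fun e => ca (e ▸ w1)) ay).symm
      exact ca' (hN w1 hc hw ha ha' haa.symm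
        (c4 w1 hc hw ha' ha haa.symm ca') (fun e => ca e.symm))
  · push Not at hcase
    have hnb : ∀ {a c}, k < vdeg G a → vdeg G c = k → ¬ G.Adj a c →
        ∃ z, G.Adj c z ∧ vdeg G z = k := by
      intro a c ha hc ac
      by_contra! hn
      have aux : ∀ {x y}, G.Adj x y → vdeg G x = k → vdeg G y = k →
          ∃ w, k < vdeg G w ∧ G.Adj c w ∧ ¬ G.Adj w x := by
        intro x y xy hx hy
        obtain ⟨w, w1, w2, w3⟩ := exists_priv_of_le (G := G) (u := c) (v := x) (by omega) xy
          (fun e => hn _ e hy) (fun e => hn _ (e ▸ xy.symm) hx)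
        refine ⟨w, ?_, w1, fun e => w2 e.symm⟩
        by_contra hw
        exact hn w w1 (hC w hw)
      obtain ⟨w, w1, w2, w3⟩ := aux xy hx hy
      obtain ⟨w', w1', w2', w3'⟩ := aux xy.symm hy hx
      have wy := hcase x y w xy hx hy w1 w3
      exact w3' (c4 xy hx hy w1 w1' (fun e => w3' (e ▸ wy)) w3)
    obtain ⟨p, hp, ap⟩ := hA a₁ ha₁
    obtain ⟨p', hp', ap'⟩ := hA a₂ ha₂
    obtain ⟨q, pq, hq⟩ := hnb ha₁ hp ap
    have aq := hcase p q a₁ pq hp hq ha₁ ap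
    have a₂p := hN pq hp hq ha₁ ha₂ (Ne.symm haa) aq ap
    have hpp : p ≠ p' := fun e => ap' (e ▸ a₂p)
    have npp : ¬ G.Adj p p' := fun e => ap' (c4 e hp hp' ha₁ ha₂ haa ap)
    have hqA : ∀ w, k < vdeg G w → G.Adj q w := by
      intro w hw
      by_cases e : a₁ = w
      · exact (e ▸ aq).symm
      · exact (c4 pq hp hq ha₁ hw e ap).symm
    obtain ⟨r, r1, r2, r3⟩ := exists_priv_of_le (G := G) (u := p') (v := q) (by omega) pq.symm
      (fun e => npp e.symm) hpp
    have hr := hC r fun e => r2 (hqA r e)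
    have hs : AltCycle G p q r p' := ⟨pq, r1.symm, npp, fun e => r2 e.symm, hpp, r3⟩
    have hne : ∀ u v : V, vdeg G u ≠ vdeg G v → u ≠ v := fun u v h e => h (e ▸ rfl)
    have n1 : a₁ ≠ p := hne _ _ (by omega)
    have n2 : a₁ ≠ q := hne _ _ (by omega)
    have n3 : a₁ ≠ r := hne _ _ (by omega)
    have n4 : a₁ ≠ p' := hne _ _ (by omega)
    have n5 : a₂ ≠ p := hne _ _ (by omega)
    have n6 : a₂ ≠ q := hne _ _ (by omega)
    have n7 : a₂ ≠ r := hne _ _ (by omega)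
    have n8 : a₂ ≠ p' := hne _ _ (by omega)
    have aa₁ := h.clique a₁ a₂ ha₁ ha₂ haa
    have := adj_of_not_adj (hG.switch hs) (k := k) (a := a₁) (a' := a₂) (x := p) (y := p')
      (by rw [switch_adj]; grind) (by rw [switch_adj]; grind)
      (by rw [hs.vdeg_switch]; omega) (by rw [hs.vdeg_switch]; omega)
      (by rw [hs.vdeg_switch]; omega) (by rw [hs.vdeg_switch]; omega)
      (by rw [switch_adj]; grind)
    rw [switch_adj] at this
    grind

theorem near_regular_of (hG : Unigraph G) (hD : ¬ Decomposable G) (h : Layers G k)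
    (hBC : ∀ b c, vdeg G b < k → vdeg G c = k → ¬ G.Adj b c) :
    ∃ e k, ∀ v, v ≠ e → vdeg G v = k := by
  obtain ⟨x, y, xy, hx, hy⟩ := h.low
  have hx' : vdeg G x = k := by
    by_contra hn
    by_cases e : vdeg G y = k
    · exact hBC x y (by omega) e xy
    · exact h.indep x y (by omega) (by omega) xy
  have hy' : vdeg G y = k := by
    by_contra hn
    exact hBC y x (by omega) hx' xy.symm
  obtain ⟨h1, h2⟩ := h.le_vdeg hG hD hBC xy hx' hy'
  by_cases hA : ∃ a, k < vdeg G a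
  · obtain ⟨a, ha⟩ := hA
    refine ⟨a, k, fun v hv => ?_⟩
    by_contra hn
    exact hv (h.high_unique hG h1 h2 xy hx' hy' (by have := h1 v; omega) ha)
  · push Not at hA
    exact ⟨x, k, fun v _ => le_antisymm (hA v) (h1 v)⟩

end Layers

theorem Decomposable.compl {G : SimpleGraph V} (h : Decomposable G) : Decomposable Gᶜ := by
  obtain ⟨A, B, W, h1, h2, h3, h4, h5, h6, h7, h8, h9⟩ := h
  refine ⟨B, A, W, by rwa [Set.union_comm B], h2.symm, by rwa [Set.union_comm B],
    by rwa [Set.union_comm B], h5, fun u hu v hv huv => ⟨huv, h7 hu hv huv⟩,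
    fun u hu v hv huv k => k.2 (h6 hu hv huv), fun b hb w hw => ⟨fun e => ?_, h9 b hb w hw⟩,
    fun a ha w hw k => k.2 (h8 a ha w hw)⟩
  exact Set.disjoint_left.1 h3 (.inr hb) (e ▸ hw)

/-- An indecomposable non-split unigraph is regular up to at most one vertex. -/
theorem Unigraph.near_regular {G : SimpleGraph V} (hG : Unigraph G) (hD : ¬ Decomposable G)
    (hs : ¬ IsSplit G) : ∃ e k, ∀ v, v ≠ e → vdeg G v = k := by
  obtain ⟨k, h⟩ := hG.exists_layers hs
  by_cases hBC : ∀ b c, vdeg G b < k → vdeg G c = k → ¬ G.Adj b c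
  · exact h.near_regular_of hG hD hBC
  · push Not at hBC
    obtain ⟨b, c, hb, hc, bc⟩ := hBC
    have hd := vdeg_compl G
    obtain ⟨e, l, hl⟩ := h.compl.near_regular_of hG.compl
      (fun hn => hD (by simpa using hn.compl)) (by
        intro a c' ha hc' hac
        have h1 := hd a
        have h2 := hd c'
        have h3 := hd c
        exact h.not_adj hG (a := a) (c := c') (by omega) (by omega) hc hb hac.2 bc)
    exact ⟨e, Fintype.card V - 1 - l, fun v hv => by have := hd v; have := hl v hv; omega⟩

end LayerAnalysis

section NearRegular

variable [Fintype V]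

/-- A unigraph without isolated or dominating vertices all of whose vertices except possibly `e` have
degree `k`. -/
structure NearReg (G : SimpleGraph V) (e : V) (k : ℕ) : Prop where
  uni : Unigraph G
  deg : ∀ v, v ≠ e → vdeg G v = k
  pos : ∀ v, 0 < vdeg G v
  le : ∀ v, vdeg G v + 2 ≤ Fintype.card V

theorem vdeg_pos_of_indecomposable {G : SimpleGraph V} (hD : ¬ Decomposable G)
    (hc : 2 ≤ Fintype.card V) (v : V) : 0 < vdeg G v := by
  by_contra hn
  have h0 : G.neighborSet v = ∅ := (Set.ncard_eq_zero).1 (by simpa [vdeg] using hn)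
  have : Nontrivial V := Fintype.one_lt_card_iff_nontrivial.1 hc
  obtain ⟨w, hw⟩ := exists_ne v
  refine hD ⟨∅, {v}, {v}ᶜ, by simp, by simp, by simp, by simp, ⟨w, hw⟩,
    by simp, ?_, by simp, ?_⟩
  · rintro u rfl w rfl h
    exact absurd rfl h
  · rintro u rfl w _ h
    exact (Set.eq_empty_iff_forall_notMem.1 h0 w) h

/-- The non-common neighbours of `a` and `c`. -/
def diffNbr (G : SimpleGraph V) (a c : V) : Set V := priv G a c ∪ priv G c a

/-- Two vertices other than `e`, not distinguished by `e`, with at least two private neighbours. -/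
structure Spread (G : SimpleGraph V) (e a c : V) : Prop where
  ne : a ≠ c
  ne_left : a ≠ e
  ne_right : c ≠ e
  iff : G.Adj a e ↔ G.Adj c e
  two : 1 < (priv G a c).ncard

theorem exists_priv_ne {G : SimpleGraph V} {u v x y : V} (h : vdeg G v = vdeg G u)
    (hx : x ∈ priv G v u) (hy : y ∈ priv G v u) (hxy : x ≠ y) (z : V) :
    ∃ w ∈ priv G u v, w ≠ z := by
  have h1 := vdeg_add_ncard_priv G u v
  have h2 : 1 < (priv G v u).ncard := (Set.one_lt_ncard_iff (Set.toFinite _)).2 ⟨x, y, hx, hy, hxy⟩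
  exact Set.exists_ne_of_one_lt_ncard (by omega) z

theorem priv_compl (G : SimpleGraph V) (a c : V) : priv Gᶜ a c = priv G c a := by
  ext x
  simp only [priv, Set.mem_ofPred_eq, SimpleGraph.compl_adj]
  have := G.ne_of_adj (a := c) (b := x)
  grind

theorem diffNbr_compl (G : SimpleGraph V) (a c : V) : diffNbr Gᶜ a c = diffNbr G a c := by
  rw [diffNbr, priv_compl, priv_compl, Set.union_comm, diffNbr]

namespace NearReg

variable {G : SimpleGraph V} {e : V} {k : ℕ}

theorem of_indecomposable (hG : Unigraph G) (hD : ¬ Decomposable G) (hc : 2 ≤ Fintype.card V)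
    (h : ∀ v, v ≠ e → vdeg G v = k) : NearReg G e k := by
  refine ⟨hG, h, vdeg_pos_of_indecomposable hD hc, fun v => ?_⟩
  have h1 := vdeg_pos_of_indecomposable (G := Gᶜ) (fun hn => hD (by simpa using hn.compl)) hc v
  have h2 := vdeg_compl G v
  omega

theorem compl (h : NearReg G e k) : NearReg Gᶜ e (Fintype.card V - 1 - k) := by
  have hd := vdeg_compl G
  refine ⟨h.uni.compl, fun v hv => ?_, fun v => ?_, fun v => ?_⟩
  · have := hd v; have := h.deg v hv; omega
  · have := hd v; have := h.le v; omega
  · have := hd v; have := h.pos v; omega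

theorem switch (h : NearReg G e k) {a b c d : V} (hs : AltCycle G a b c d) :
    NearReg (Tysh.switch G a b c d) e k :=
  ⟨h.uni.switch hs, fun v hv => by rw [hs.vdeg_switch]; exact h.deg v hv,
    fun v => by rw [hs.vdeg_switch]; exact h.pos v,
    fun v => by rw [hs.vdeg_switch]; exact h.le v⟩

variable {a c : V}

theorem spread_symm (h : NearReg G e k) (hs : Spread G e a c) : Spread G e c a := by
  have h1 := vdeg_add_ncard_priv G a c
  rw [h.deg a hs.ne_left, h.deg c hs.ne_right] at h1
  exact ⟨hs.ne.symm, hs.ne_right, hs.ne_left, hs.iff.symm, by have := hs.two; omega⟩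

theorem spread_compl (h : NearReg G e k) (hs : Spread G e a c) : Spread Gᶜ e a c := by
  refine ⟨hs.ne, hs.ne_left, hs.ne_right, ?_, by rw [priv_compl]; exact (h.spread_symm hs).two⟩
  have := hs.iff
  simp [hs.ne_left, hs.ne_right, this]

theorem ne_of_mem_diffNbr (hs : Spread G e a c) {w : V} (hw : w ∈ diffNbr G a c) :
    w ≠ e ∧ w ≠ a ∧ w ≠ c := by
  have := hs.iff
  rcases hw with ⟨h1, h2, h3⟩ | ⟨h1, h2, h3⟩
  · exact ⟨fun e => h2 (by rw [e, ← this, ← e]; exact h1), h1.ne', h3⟩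
  · exact ⟨fun e => h2 (by rw [e, this, ← e]; exact h1), h3, h1.ne'⟩

theorem adj_iff_adj (h : NearReg G e k) (hs : Spread G e a c) {b f g : V} (hb : b ∈ priv G a c)
    (hf : f ∈ priv G a c) (hbf : b ≠ f) (hg : g ∈ priv G c a) : G.Adj b f ↔ G.Adj b g := by
  obtain ⟨d, hd, hdg⟩ := Set.exists_ne_of_one_lt_ncard (h.spread_symm hs).two g
  have hfe := (ne_of_mem_diffNbr hs (.inl hf)).1
  have hge := (ne_of_mem_diffNbr hs (.inr hg)).1
  have hdeg : vdeg G f = vdeg G g := by rw [h.deg f hfe, h.deg g hge]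
  obtain ⟨b1, b2, b3⟩ := hb
  obtain ⟨f1, f2, f3⟩ := hf
  obtain ⟨g1, g2, g3⟩ := hg
  obtain ⟨d1, d2, d3⟩ := hd
  have hc : AltCycle G a b c d := ⟨b1, d1, d2, b2, d3.symm, b3.symm⟩
  have bg : b ≠ g := fun e => g2 (e ▸ b1)
  have fd : f ≠ d := fun e => f2 (e ▸ d1)
  have fg : f ≠ g := fun e => f2 (e ▸ g1)
  have i1 := ind_of_adj f1.symm
  have i2 := ind_of_not_adj (fun e => f2 (G.adj_symm e) : ¬ G.Adj f c)
  have i3 := ind_of_adj g1.symm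
  have i4 := ind_of_not_adj (fun e => g2 (G.adj_symm e) : ¬ G.Adj g a)
  constructor
  · intro bf
    by_contra nbg
    obtain ⟨x, ⟨x1, x2, x3⟩, hx⟩ := exists_priv_ne (u := g) (v := f) (x := a) (y := b) hdeg
      ⟨f1.symm, fun e => g2 e.symm, g3.symm⟩ ⟨bf.symm, fun e => nbg e.symm, bg⟩ b1.ne c
    have := h.uni.ind_sub_ind (f := f) (g := g) (x := x) hc
      ⟨bf, x1.symm, nbg, fun e => x2 e.symm, bg, x3⟩ (fun e => g2 (e ▸ x1.symm)) hx f1.ne' f3 fd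
      g3 g1.ne' hdg.symm
    omega
  · intro bg'
    by_contra nbf
    obtain ⟨x, ⟨x1, x2, x3⟩, hx⟩ := exists_priv_ne (u := f) (v := g) (x := c) (y := b) hdeg.symm
      ⟨g1.symm, fun e => f2 e.symm, f3.symm⟩ ⟨bg'.symm, fun e => nbf e.symm, hbf⟩ b3.symm a
    have := h.uni.ind_sub_ind (f := g) (g := f) (x := x) hc
      ⟨bg', x1.symm, nbf, fun e => x2 e.symm, hbf, x3⟩ hx (fun e => f2 (e ▸ x1.symm)) g3 g1.ne'
      hdg.symm f1.ne' f3 fd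
    omega

/-- The non-common neighbours of a spread pair form a clique or an independent set. -/
theorem isClique_or_isIndep (h : NearReg G e k) (hs : Spread G e a c) :
    G.IsClique (diffNbr G a c) ∨ IsIndep G (diffNbr G a c) := by
  have hs' := h.spread_symm hs
  obtain ⟨b₀, f₀, hb₀, hf₀, hbf⟩ := (Set.one_lt_ncard_iff (Set.toFinite _)).1 hs.two
  obtain ⟨d₀, g₀, hd₀, hg₀, hdg⟩ := (Set.one_lt_ncard_iff (Set.toFinite _)).1 hs'.two
  have A : ∀ b ∈ priv G a c, ∀ f ∈ priv G a c, b ≠ f → ∀ g ∈ priv G c a,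
      (G.Adj b f ↔ G.Adj b g) := fun b hb f hf n g hg => h.adj_iff_adj hs hb hf n hg
  have B : ∀ b ∈ priv G c a, ∀ f ∈ priv G c a, b ≠ f → ∀ g ∈ priv G a c,
      (G.Adj b f ↔ G.Adj b g) := fun b hb f hf n g hg => h.adj_iff_adj hs' hb hf n hg
  have A1 : ∀ b ∈ priv G a c, ∀ f ∈ priv G a c, b ≠ f → (G.Adj b f ↔ G.Adj b₀ f₀) := by
    intro b hb f hf n
    rw [A b hb f hf n d₀ hd₀, G.adj_comm, ← B d₀ hd₀ g₀ hg₀ hdg b hb,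
      B d₀ hd₀ g₀ hg₀ hdg b₀ hb₀, G.adj_comm, ← A b₀ hb₀ f₀ hf₀ hbf d₀ hd₀]
  have A2 : ∀ b ∈ priv G a c, ∀ g ∈ priv G c a, (G.Adj b g ↔ G.Adj b₀ f₀) := by
    intro b hb g hg
    obtain ⟨f, hf, hfb⟩ := Set.exists_ne_of_one_lt_ncard hs.two b
    rw [← A b hb f hf hfb.symm g hg, A1 b hb f hf hfb.symm]
  have A3 : ∀ b ∈ priv G c a, ∀ f ∈ priv G c a, b ≠ f → (G.Adj b f ↔ G.Adj b₀ f₀) := by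
    intro b hb f hf n
    rw [B b hb f hf n b₀ hb₀, G.adj_comm, A2 b₀ hb₀ b hb]
  have A4 : ∀ u ∈ diffNbr G a c, ∀ v ∈ diffNbr G a c, u ≠ v → (G.Adj u v ↔ G.Adj b₀ f₀) := by
    rintro u (hu | hu) v (hv | hv) n
    · exact A1 u hu v hv n
    · exact A2 u hu v hv
    · rw [G.adj_comm]; exact A2 v hv u hu
    · exact A3 u hu v hv n
  by_cases hadj : G.Adj b₀ f₀
  · exact .inl fun u hu v hv n => (A4 u hu v hv n).2 hadj
  · exact .inr fun u hu v hv n => mt (A4 u hu v hv n).1 hadj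

theorem four_le_ncard_diffNbr (h : NearReg G e k) (hs : Spread G e a c) :
    4 ≤ (diffNbr G a c).ncard := by
  have hs' := h.spread_symm hs
  rw [diffNbr, Set.ncard_union_eq]
  · have := hs.two; have := hs'.two; omega
  · rw [Set.disjoint_left]
    exact fun x h1 h2 => h2.2.1 h1.1

theorem adj_of_isIndep (h : NearReg G e k) (hs : Spread G e a c)
    (hW : IsIndep G (diffNbr G a c)) {b f y z : V} (hb : b ∈ diffNbr G a c)
    (hf : f ∈ diffNbr G a c) (hbf : b ≠ f) (hy : G.Adj b y) (hya : y ≠ a) (hyc : y ≠ c)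
    (hz : G.Adj f z) (hza : z ≠ a) (hzc : z ≠ c) (hyz : y ≠ z) : G.Adj y z := by
  by_contra hn
  have hc : AltCycle G b y z f := ⟨hy, hz.symm, hW hb hf hbf, fun e => hn e.symm, hbf, hyz.symm⟩
  obtain ⟨-, hba, hbc⟩ := ne_of_mem_diffNbr hs hb
  obtain ⟨-, hfa, hfc⟩ := ne_of_mem_diffNbr hs hf
  have hyW : y ∉ diffNbr G a c := fun hyW => hW hb hyW hy.ne hy
  have hzW : z ∉ diffNbr G a c := fun hzW => hW hf hzW hz.ne hz
  have hac : ∀ p q, p = a ∨ p = c → ((Tysh.switch G b y z f).Adj p q ↔ G.Adj p q) := by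
    intro p q hp
    have := G.ne_of_adj (a := p) (b := q)
    rw [switch_adj]
    rcases hp with rfl | rfl <;> grind
  have hp : ∀ p q, p = a ∨ p = c → q = a ∨ q = c →
      priv (Tysh.switch G b y z f) p q = priv G p q := by
    intro p q hp hq
    ext x
    simp only [priv, Set.mem_ofPred_eq, hac p x hp, hac q x hq]
  have hW' : diffNbr (Tysh.switch G b y z f) a c = diffNbr G a c := by
    rw [diffNbr, hp a c (.inl rfl) (.inr rfl), hp c a (.inr rfl) (.inl rfl), diffNbr]
  have hs' : Spread (Tysh.switch G b y z f) e a c :=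
    ⟨hs.ne, hs.ne_left, hs.ne_right, by rw [hac a e (.inl rfl), hac c e (.inr rfl)]; exact hs.iff,
      by rw [hp a c (.inl rfl) (.inr rfl)]; exact hs.two⟩
  have hbf' : (Tysh.switch G b y z f).Adj b f := by rw [switch_adj]; grind
  obtain ⟨w, ⟨hw, hwb⟩, hwf⟩ : ∃ w ∈ diffNbr G a c \ {b}, w ≠ f := by
    refine Set.exists_ne_of_one_lt_ncard ?_ f
    have := Set.ncard_sdiff_singleton_add_one hb
    have := h.four_le_ncard_diffNbr hs
    omega
  have hwb' : b ≠ w := fun e => hwb e.symm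
  rcases (h.switch hc).isClique_or_isIndep hs' with H | H
  · rw [hW'] at H
    have h1 := H hb hw hwb'
    have h2 := hW hb hw hwb'
    rw [switch_adj] at h1
    have h3 : w ≠ y := fun e => hyW (e ▸ hw)
    have h4 : w ≠ z := fun e => hzW (e ▸ hw)
    have h5 := hy.ne
    grind
  · rw [hW'] at H
    exact H hb hf hbf hbf'

theorem ncard_neighborSet_sdiff (h : NearReg G e k) (hs : Spread G e a c) {w : V}
    (hw : w ∈ diffNbr G a c) : (G.neighborSet w \ {a, c}).ncard + 1 = k := by
  have hk := h.deg w (ne_of_mem_diffNbr hs hw).1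
  rcases hw with ⟨h1, h2, -⟩ | ⟨h1, h2, -⟩
  · have : G.neighborSet w \ {a, c} = G.neighborSet w \ {a} := by
      ext x
      have : x = c → ¬ G.Adj w x := by rintro rfl e; exact h2 e.symm
      simp; tauto
    rw [this, Set.ncard_sdiff_singleton_add_one (s := G.neighborSet w) h1.symm, ← hk, vdeg]
  · have : G.neighborSet w \ {a, c} = G.neighborSet w \ {c} := by
      ext x
      have : x = a → ¬ G.Adj w x := by rintro rfl e; exact h2 e.symm
      simp; tauto
    rw [this, Set.ncard_sdiff_singleton_add_one (s := G.neighborSet w) h1.symm, ← hk, vdeg]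

theorem not_adj_three (h : NearReg G e k) (hs : Spread G e a c)
    (hW : IsIndep G (diffNbr G a c)) {z w₁ w₂ w₃ : V} (hz : z ≠ e) (hza : z ≠ a) (hzc : z ≠ c)
    (h1 : w₁ ∈ diffNbr G a c) (h2 : w₂ ∈ diffNbr G a c) (h3 : w₃ ∈ diffNbr G a c)
    (h12 : w₁ ≠ w₂) (h13 : w₁ ≠ w₃) (h23 : w₂ ≠ w₃) (a1 : G.Adj z w₁) (a2 : G.Adj z w₂)
    (a3 : G.Adj z w₃) : False := by
  have hN : ∀ w ∈ diffNbr G a c, w ∉ (G.neighborSet w₁ \ {a, c}) \ {z} := fun w hw hn =>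
    hW h1 hw hn.1.1.ne hn.1.1
  have hsub : insert w₁ (insert w₂ (insert w₃ ((G.neighborSet w₁ \ {a, c}) \ {z}))) ⊆
      G.neighborSet z := by
    rintro v (rfl | rfl | rfl | ⟨⟨h4, h5⟩, h6⟩)
    · exact a1
    · exact a2
    · exact a3
    · simp only [Set.mem_insert_iff, Set.mem_singleton_iff, not_or] at h5 h6
      exact (h.adj_of_isIndep hs hW h1 h2 h12 h4 h5.1 h5.2 a2.symm hza hzc h6).symm
  have := Set.ncard_le_ncard hsub
  rw [Set.ncard_insert_of_notMem (by simp only [Set.mem_insert_iff, not_or]; exact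
      ⟨h12, h13, hN _ h1⟩),
    Set.ncard_insert_of_notMem (by simp only [Set.mem_insert_iff, not_or]; exact ⟨h23, hN _ h2⟩),
    Set.ncard_insert_of_notMem (hN _ h3)] at this
  have h7 := h.ncard_neighborSet_sdiff hs h1
  have h8 := Set.ncard_sdiff_singleton_add_one (s := G.neighborSet w₁ \ {a, c}) (a := z)
    ⟨a1.symm, by simp [hza, hzc]⟩
  have h9 := h.deg z hz
  rw [vdeg] at h9
  omega

theorem not_isIndep (h : NearReg G e k) (hs : Spread G e a c) (hk : 3 ≤ k) :
    ¬ IsIndep G (diffNbr G a c) := by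
  intro hW
  have hne : (diffNbr G a c).Nonempty := by
    apply Set.nonempty_of_ncard_ne_zero
    have := h.four_le_ncard_diffNbr hs
    omega
  obtain ⟨b, hb⟩ := hne
  have hNb := h.ncard_neighborSet_sdiff hs hb
  obtain ⟨z, ⟨hbz, hz⟩, hze⟩ := Set.exists_ne_of_one_lt_ncard
    (s := G.neighborSet b \ {a, c}) (by omega) e
  simp only [Set.mem_insert_iff, Set.mem_singleton_iff, not_or] at hz
  have hrest : 2 < (diffNbr G a c \ {b}).ncard := by
    have := Set.ncard_sdiff_singleton_add_one hb
    have := h.four_le_ncard_diffNbr hs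
    omega
  have hNz : ∀ f ∈ diffNbr G a c, f ≠ b → ¬ G.Adj z f →
      G.neighborSet z = insert b (G.neighborSet f \ {a, c}) := by
    intro f hf hfb hzf
    symm
    apply Set.eq_of_subset_of_ncard_le
    · rintro v (rfl | ⟨h1, h2⟩)
      · exact hbz.symm
      · simp only [Set.mem_insert_iff, Set.mem_singleton_iff, not_or] at h2
        exact h.adj_of_isIndep hs hW hb hf hfb.symm hbz hz.1 hz.2 h1 h2.1 h2.2
          (fun e => hzf (e ▸ G.adj_symm h1))
    · rw [Set.ncard_insert_of_notMem (fun hn => hW hf hb hfb hn.1),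
        h.ncard_neighborSet_sdiff hs hf, ← h.deg z hze, vdeg]
    · exact Set.toFinite _
  have hzW : ∀ w ∈ diffNbr G a c, w ≠ b → ¬ G.Adj z w := by
    intro w hw hwb hzw
    obtain ⟨f, hf, hfw⟩ := Set.exists_ne_of_one_lt_ncard (by omega : 1 < (diffNbr G a c \ {b}).ncard) w
    have hfb : f ≠ b := hf.2
    have hzf : ¬ G.Adj z f := fun hzf => h.not_adj_three hs hW hze hz.1 hz.2 hb hw hf.1
      hwb.symm hfb.symm hfw.symm hbz.symm hzw hzf
    have : w ∈ G.neighborSet z := hzw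
    rw [hNz f hf.1 hfb hzf] at this
    rcases this with e | e
    · exact hwb e
    · exact hW hf.1 hw hfw e.1
  obtain ⟨f, g, j, hf, hg, hj, hfg, hfj, hgj⟩ := (Set.two_lt_ncard_iff (Set.toFinite _)).1 hrest
  obtain ⟨y, hy, hye⟩ := Set.exists_ne_of_one_lt_ncard
    (s := G.neighborSet f \ {a, c}) (by have := h.ncard_neighborSet_sdiff hs hf.1; omega) e
  have key : ∀ w ∈ diffNbr G a c \ {b}, G.Adj y w := by
    intro w hw
    have h1 : y ∈ G.neighborSet z := by
      rw [hNz f hf.1 hf.2 (hzW f hf.1 hf.2)]; exact .inr hy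
    rw [hNz w hw.1 hw.2 (hzW w hw.1 hw.2)] at h1
    rcases h1 with e | e
    · exact absurd (e ▸ hy.1) (hW hf.1 hb hf.2)
    · exact G.adj_symm e.1
  have hy2 := hy.2
  simp only [Set.mem_insert_iff, Set.mem_singleton_iff, not_or] at hy2
  exact h.not_adj_three hs hW hye hy2.1 hy2.2 hf.1 hg.1 hj.1 hfg hfj hgj (key f hf) (key g hg)
    (key j hj)

theorem not_spread (h : NearReg G e k) (hk : 3 ≤ k) (hk' : k + 4 ≤ Fintype.card V) :
    ¬ Spread G e a c := by
  intro hs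
  rcases h.isClique_or_isIndep hs with H | H
  · refine h.compl.not_isIndep (h.spread_compl hs) (by omega) ?_
    rw [diffNbr_compl]
    exact fun u hu v hv n hadj => hadj.2 (H hu hv n)
  · exact h.not_isIndep hs hk H

theorem exists_lt_ncard_priv (h : NearReg G e k) (hk : 3 ≤ k) (hk' : k + 4 ≤ Fintype.card V)
    (ea : G.Adj e a) (ec : G.Adj e c) (hac : a ≠ c) (nac : ¬ G.Adj a c) :
    ∃ H : SimpleGraph V, NearReg H e k ∧ H.Adj e a ∧ H.Adj e c ∧ ¬ H.Adj a c ∧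
      (priv G a c).ncard < (priv H a c).ncard := by
  have h1 : ¬ 1 < (priv G a c).ncard := fun hn =>
    h.not_spread hk hk' ⟨hac, ea.ne', ec.ne', by simp [ea.symm, ec.symm], hn⟩
  have hka := h.deg a ea.ne'
  have hkc := h.deg c ec.ne'
  have hp : priv G a c = G.neighborSet a \ G.neighborSet c := by
    ext x
    have : G.Adj a x → x ≠ c := fun h2 e => nac (e ▸ h2)
    simp [priv]; tauto
  have e1 := Set.ncard_inter_add_ncard_sdiff_eq_ncard (G.neighborSet a) (G.neighborSet c)
    (Set.toFinite _)
  have e2 := Set.ncard_sdiff_add_ncard (G.neighborSet a) (G.neighborSet c)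
    (Set.toFinite _) (Set.toFinite _)
  rw [← hp] at e1 e2
  simp only [vdeg] at hka hkc
  obtain ⟨y, ⟨ay, cy⟩, hye⟩ := Set.exists_ne_of_one_lt_ncard
    (s := G.neighborSet a ∩ G.neighborSet c) (by omega) e
  have hz : (insert a (insert c (G.neighborSet a ∪ G.neighborSet c)))ᶜ.Nonempty := by
    apply Set.nonempty_of_ncard_ne_zero
    have := Set.ncard_add_ncard_compl (insert a (insert c (G.neighborSet a ∪ G.neighborSet c)))
    rw [Nat.card_eq_fintype_card] at this
    have h3 := Set.ncard_insert_le a (insert c (G.neighborSet a ∪ G.neighborSet c))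
    have h4 := Set.ncard_insert_le c (G.neighborSet a ∪ G.neighborSet c)
    omega
  obtain ⟨z, hz⟩ := hz
  simp only [Set.mem_compl_iff, Set.mem_insert_iff, Set.mem_union, not_or,
    SimpleGraph.mem_neighborSet] at hz ay cy
  obtain ⟨za, zc, az, cz⟩ := hz
  have hze : z ≠ e := fun e => az (e ▸ ea.symm)
  obtain ⟨x, x1, x2, x3⟩ := exists_priv_of_le (G := G) (u := z) (v := y)
    (by rw [h.deg y hye, h.deg z hze]) cy.symm (fun e => cz e.symm) (Ne.symm zc)
  have hxa : x ≠ a := fun e => x2 (e ▸ ay.symm)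
  have hxc : x ≠ c := fun e => x2 (e ▸ cy.symm)
  have hyz : y ≠ z := fun e => az (e ▸ ay)
  have hs : AltCycle G c y x z := ⟨cy, x1.symm, cz, fun e => x2 e.symm, Ne.symm zc, x3⟩
  have n1 := ea.ne
  have n2 := ec.ne
  have n3 := ay.ne
  have n4 := cy.ne
  refine ⟨_, h.switch hs, ?_, ?_, ?_, ?_⟩
  · rw [switch_adj]; grind
  · rw [switch_adj]; grind
  · rw [switch_adj]; grind
  · have hy : y ∉ priv G a c := fun hn => hn.2.1 cy
    have : insert y (priv G a c) ⊆ priv (Tysh.switch G c y x z) a c := by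
      rintro v (rfl | ⟨v1, v2, v3⟩)
      · refine ⟨?_, ?_, n4.symm⟩ <;> rw [switch_adj] <;> grind
      · have := v1.ne
        have : v ≠ z := fun e => az (e ▸ v1)
        refine ⟨?_, ?_, v3⟩ <;> rw [switch_adj] <;> grind
    have := Set.ncard_le_ncard this
    rw [Set.ncard_insert_of_notMem hy] at this
    omega

theorem false_of_adj (h : NearReg G e k) (hk : 3 ≤ k) (hk' : k + 4 ≤ Fintype.card V)
    (ea : G.Adj e a) (ec : G.Adj e c) (hac : a ≠ c) : False := by
  obtain ⟨H, hH, ea, ec, nac⟩ : ∃ H : SimpleGraph V, NearReg H e k ∧ H.Adj e a ∧ H.Adj e c ∧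
      ¬ H.Adj a c := by
    by_cases ac : G.Adj a c
    · have hz : (insert a (G.neighborSet a))ᶜ.Nonempty := by
        apply Set.nonempty_of_ncard_ne_zero
        have := Set.ncard_add_ncard_compl (insert a (G.neighborSet a))
        rw [Nat.card_eq_fintype_card] at this
        have h3 := Set.ncard_insert_le a (G.neighborSet a)
        have := h.deg a ea.ne'
        rw [vdeg] at this
        omega
      obtain ⟨z, hz⟩ := hz
      simp only [Set.mem_compl_iff, Set.mem_insert_iff, not_or, SimpleGraph.mem_neighborSet] at hz
      obtain ⟨za, az⟩ := hz
      have hze : z ≠ e := fun e => az (e ▸ ea.symm)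
      obtain ⟨x, x1, x2, x3⟩ := exists_priv_of_le (G := G) (u := z) (v := c)
        (by rw [h.deg c ec.ne', h.deg z hze]) ac.symm (fun e => az e.symm) (Ne.symm za)
      have hs : AltCycle G a c x z := ⟨ac, x1.symm, az, fun e => x2 e.symm, Ne.symm za, x3⟩
      have n1 := ea.ne
      have n2 := ec.ne
      have n3 : x ≠ e := fun e' => x2 (e' ▸ ec.symm)
      have n4 : z ≠ c := fun e => az (e ▸ ac)
      have n5 : x ≠ a := fun e => az (e ▸ x1.symm)
      refine ⟨_, h.switch hs, ?_, ?_, ?_⟩ <;> rw [switch_adj] <;> grind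
    · exact ⟨G, h, ea, ec, ac⟩
  obtain ⟨H₁, h₁, ea₁, ec₁, n₁, l₁⟩ := hH.exists_lt_ncard_priv hk hk' ea ec hac nac
  obtain ⟨H₂, h₂, ea₂, ec₂, n₂, l₂⟩ := h₁.exists_lt_ncard_priv hk hk' ea₁ ec₁ hac n₁
  exact h₂.not_spread hk hk' ⟨hac, ea.ne', ec.ne', by simp [ea₂.symm, ec₂.symm], by omega⟩

theorem middle_false (h : NearReg G e k) (hk : 3 ≤ k) (hk' : k + 4 ≤ Fintype.card V) : False := by
  have hd := vdeg_compl G e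
  by_cases he : 1 < vdeg G e
  · obtain ⟨a, c, ea, ec, hac⟩ := (Set.one_lt_ncard_iff (Set.toFinite _)).1 he
    exact h.false_of_adj hk hk' ea ec hac
  · obtain ⟨a, c, ea, ec, hac⟩ := (Set.one_lt_ncard_iff (Set.toFinite _)).1
      (show 1 < vdeg Gᶜ e by omega)
    exact h.compl.false_of_adj (by omega) (by omega) ea ec hac

end NearReg

end NearRegular

section DegreeTwo

variable [Fintype V]

theorem ncard_commonNeighbors (G : SimpleGraph V) (a b : V) :
    ((G.commonNeighbors a b).ncard : ℤ) = ∑ u, ind G u a * ind G u b := by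
  classical
  have : ∀ u, ind G u a * ind G u b = if u ∈ G.commonNeighbors a b then 1 else 0 := by
    intro u
    simp only [ind, SimpleGraph.mem_commonNeighbors, G.adj_comm u]
    split_ifs <;> simp_all
  simp only [this, Finset.sum_boole]
  rw [Set.ncard_eq_toFinset_card']
  congr 2
  ext
  simp

theorem Unigraph.ncard_commonNeighbors_add {G : SimpleGraph V} (hG : Unigraph G) {a b c d : V}
    (h : AltCycle G a b c d) (ac : ¬ G.Adj a c) (bd : ¬ G.Adj b d) :
    (G.commonNeighbors a b).ncard + (G.commonNeighbors c d).ncard =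
      (G.commonNeighbors a d).ncard + (G.commonNeighbors c b).ncard := by
  have h1 := hG.sum_mul_eq h
  rw [ind_of_not_adj ac, ind_of_not_adj bd] at h1
  simp only [sub_mul, mul_sub, Finset.sum_sub_distrib, ← ncard_commonNeighbors] at h1
  omega

theorem ncard_commonNeighbors_eq_zero {G : SimpleGraph V} {a b : V}
    (h : ∀ x, G.Adj a x → ¬ G.Adj b x) : (G.commonNeighbors a b).ncard = 0 := by
  rw [Set.ncard_eq_zero, Set.eq_empty_iff_forall_notMem]
  exact fun x hx => h x hx.1 hx.2

theorem ncard_commonNeighbors_pos {G : SimpleGraph V} {a b x : V}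
    (h : G.Adj a x) (h' : G.Adj b x) : 0 < (G.commonNeighbors a b).ncard :=
  (Set.ncard_pos (Set.toFinite _)).2 ⟨x, h, h'⟩

namespace NearReg

variable {G : SimpleGraph V} {e : V} {k : ℕ}

theorem exists_adj_ne (h : NearReg G e 2) {v : V} (hv : v ≠ e) (x : V) :
    ∃ y, G.Adj v y ∧ y ≠ x := by
  have := h.deg v hv
  exact Set.exists_ne_of_one_lt_ncard (s := G.neighborSet v) (by rw [vdeg] at this; omega) x

theorem eq_or_eq_of_adj (h : NearReg G e 2) {v x y z : V} (hv : v ≠ e) (hx : G.Adj v x)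
    (hy : G.Adj v y) (hxy : x ≠ y) (hz : G.Adj v z) : z = x ∨ z = y := by
  have h1 := h.deg v hv
  have h2 : ({x, y} : Set V) = G.neighborSet v := by
    apply Set.eq_of_subset_of_ncard_le
    · rintro w (rfl | rfl)
      exacts [hx, hy]
    · rw [Set.ncard_pair hxy]; exact h1.le
    · exact Set.toFinite _
  have : z ∈ ({x, y} : Set V) := h2 ▸ hz
  simpa using this

theorem not_adj_of_triangle (h : NearReg G e 2) {a b c d : V} (ec : G.Adj e c) (ed : G.Adj e d)
    (cd : G.Adj c d) (ae : a ≠ e) (be : b ≠ e) (ea : ¬ G.Adj e a) (eb : ¬ G.Adj e b) :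
    ¬ G.Adj a b := by
  intro ab
  have nc : ∀ x, G.Adj c x → x = e ∨ x = d := fun x =>
    h.eq_or_eq_of_adj ec.ne' ec.symm cd ed.ne
  have nd : ∀ x, G.Adj d x → x = e ∨ x = c := fun x =>
    h.eq_or_eq_of_adj ed.ne' ed.symm cd.symm ec.ne
  have ca : ¬ G.Adj c a := fun k => (nc a k).elim ae fun k => ea (k ▸ ed)
  have cb : ¬ G.Adj c b := fun k => (nc b k).elim be fun k => eb (k ▸ ed)
  have da : ¬ G.Adj d a := fun k => (nd a k).elim ae fun k => ea (k ▸ ec)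
  have db : ¬ G.Adj d b := fun k => (nd b k).elim be fun k => eb (k ▸ ec)
  have := h.uni.ncard_commonNeighbors_add (a := a) (b := b) (c := c) (d := d)
    ⟨ab, cd, fun k => da k.symm, cb, fun k => ea (k ▸ ed), fun k => eb (k ▸ ec)⟩
    (fun k => ca k.symm) (fun k => db k.symm)
  have h1 := ncard_commonNeighbors_pos ec.symm ed.symm
  have h2 : (G.commonNeighbors a d).ncard = 0 := ncard_commonNeighbors_eq_zero fun x hx hd => by
    rcases nd x hd with rfl | rfl
    · exact ea hx.symm
    · exact ca hx.symm
  have h3 : (G.commonNeighbors c b).ncard = 0 := ncard_commonNeighbors_eq_zero fun x hc hb => by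
    rcases nc x hc with rfl | rfl
    · exact eb hb.symm
    · exact db hb.symm
  omega

theorem false_of_paths (h : NearReg G e 2) {a b x y : V} (ea : G.Adj e a) (ey : G.Adj e y)
    (ab : G.Adj a b) (xy : G.Adj x y) (eb : ¬ G.Adj e b) (ex : ¬ G.Adj e x) (be : b ≠ e)
    (xe : x ≠ e) (bx : b ≠ x) (nbx : ¬ G.Adj b x) : False := by
  have na : ∀ z, G.Adj a z → z = e ∨ z = b := fun z =>
    h.eq_or_eq_of_adj ea.ne' ea.symm ab be.symm
  have ny : ∀ z, G.Adj y z → z = e ∨ z = x := fun z =>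
    h.eq_or_eq_of_adj ey.ne' ey.symm xy.symm xe.symm
  have ay : ¬ G.Adj a y := fun k => (na y k).elim ey.ne' fun k => eb (k ▸ ey)
  have ax : ¬ G.Adj a x := fun k => (na x k).elim xe bx.symm
  have yb : ¬ G.Adj y b := fun k => (ny b k).elim be bx
  have := h.uni.ncard_commonNeighbors_add (a := a) (b := b) (c := x) (d := y)
    ⟨ab, xy, ay, fun k => nbx k.symm, fun k => ax (k ▸ xy.symm), bx.symm⟩ ax (fun k => yb k.symm)
  have h1 := ncard_commonNeighbors_pos ea.symm ey.symm
  have h2 : (G.commonNeighbors a b).ncard = 0 := ncard_commonNeighbors_eq_zero fun z hz hb => by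
    rcases na z hz with rfl | rfl
    · exact eb hb.symm
    · exact hb.ne rfl
  have h3 : (G.commonNeighbors x y).ncard = 0 := ncard_commonNeighbors_eq_zero fun z hx hy => by
    rcases ny z hy with rfl | rfl
    · exact ex hx.symm
    · exact hx.ne rfl
  omega

theorem eq_or_adj_of_paths (h : NearReg G e 2) {c c' d d' : V} (ec : G.Adj e c) (ec' : G.Adj e c')
    (cc' : c ≠ c') (cd : G.Adj c d) (cd' : G.Adj c' d') (ed : ¬ G.Adj e d) (ed' : ¬ G.Adj e d')
    (de : d ≠ e) (de' : d' ≠ e) : d = d' ∨ G.Adj d d' := by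
  by_contra! hn
  obtain ⟨n1, n2⟩ := hn
  have n3 : ¬ G.Adj c c' := fun k =>
    (h.eq_or_eq_of_adj ec.ne' ec.symm cd de.symm k).elim ec'.ne' fun k => ed (k ▸ ec')
  have hs : AltCycle G c d d' c' := ⟨cd, cd'.symm, n3, fun k => n2 k.symm, cc', n1.symm⟩
  have m1 := ec.ne
  have m2 := ec'.ne
  have m3 := cd.ne
  have m4 := cd'.ne
  refine (h.switch hs).not_adj_of_triangle (a := d) (b := d') (c := c) (d := c') ?_ ?_ ?_ de de'
    ?_ ?_ ?_ <;> rw [switch_adj] <;> grind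

theorem false_of_adj_of_four_le (h : NearReg G e 2) (he : 4 ≤ vdeg G e) {a b : V}
    (ab : G.Adj a b) (ea : ¬ G.Adj e a) (eb : ¬ G.Adj e b) (ae : a ≠ e) (be : b ≠ e) : False := by
  have hout : ∀ c, G.Adj e c → ∃ d, G.Adj c d ∧ ¬ G.Adj e d ∧ d ≠ e := by
    intro c hc
    obtain ⟨d, hd, hde⟩ := h.exists_adj_ne hc.ne' e
    exact ⟨d, hd, fun ed => h.not_adj_of_triangle hc ed hd ae be ea eb ab, hde⟩
  have hthree : ∀ v x y z, v ≠ e → G.Adj x v → G.Adj v y → G.Adj v z → x ≠ y → y ≠ z →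
      x ≠ z → False := by
    intro v x y z hv hx hy hz n1 n2 n3
    rcases h.eq_or_eq_of_adj hv hx.symm hy n1 hz with k | k
    exacts [n3 k.symm, n2 k.symm]
  obtain ⟨c₁, c₂, c₃, e1, e2, e3, n12, n13, n23⟩ :=
    (Set.two_lt_ncard_iff (Set.toFinite (G.neighborSet e))).1 (by rw [vdeg] at he; omega)
  obtain ⟨d₁, k1, f1, g1⟩ := hout c₁ e1
  obtain ⟨d₂, k2, f2, g2⟩ := hout c₂ e2
  obtain ⟨d₃, k3, f3, g3⟩ := hout c₃ e3
  have hne : ∀ {c c' c'' d d' d'' : V}, G.Adj e c → G.Adj e c' → G.Adj e c'' → G.Adj c d →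
      G.Adj c' d' → G.Adj c'' d'' → ¬ G.Adj e d → ¬ G.Adj e d'' → d ≠ e → d'' ≠ e → c ≠ c' →
      c ≠ c'' → c' ≠ c'' → d ≠ d' := by
    rintro c c' c'' d d' d'' ec ec' ec'' cd cd' cd'' ed ed'' de de'' n n' n'' rfl
    rcases h.eq_or_adj_of_paths ec ec'' n' cd cd'' ed ed'' de de'' with rfl | k
    · exact hthree d c c' c'' de cd cd'.symm cd''.symm n n'' n'
    · exact hthree d c c' d'' de cd cd'.symm k n (fun k => ed'' (k ▸ ec')) fun k => ed'' (k ▸ ec)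
  have m12 := hne e1 e2 e3 k1 k2 k3 f1 f3 g1 g3 n12 n13 n23
  have m13 := hne e1 e3 e2 k1 k3 k2 f1 f2 g1 g2 n13 n12 n23.symm
  have m23 := hne e2 e3 e1 k2 k3 k1 f2 f1 g2 g1 n23 n12.symm n13.symm
  exact hthree d₁ c₁ d₂ d₃ g1 k1
    ((h.eq_or_adj_of_paths e1 e2 n12 k1 k2 f1 f2 g1 g2).resolve_left m12)
    ((h.eq_or_adj_of_paths e1 e3 n13 k1 k3 f1 f3 g1 g3).resolve_left m13)
    (fun k => f2 (k ▸ e1)) m23 (fun k => f3 (k ▸ e1))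

theorem false_of_adj_of_eq_two (h : NearReg G e 2) (he : vdeg G e = 2)
    (hc : 6 ≤ Fintype.card V) {a b : V} (ab : G.Adj a b) (ea : ¬ G.Adj e a) (eb : ¬ G.Adj e b)
    (ae : a ≠ e) (be : b ≠ e) : False := by
  have hout : ∀ c, G.Adj e c → ∃ d, G.Adj c d ∧ ¬ G.Adj e d ∧ d ≠ e := by
    intro c hc
    obtain ⟨d, hd, hde⟩ := h.exists_adj_ne hc.ne' e
    exact ⟨d, hd, fun ed => h.not_adj_of_triangle hc ed hd ae be ea eb ab, hde⟩
  obtain ⟨c, c', cc', hN⟩ := Set.ncard_eq_two.1 he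
  have ec : G.Adj e c := (hN ▸ Set.mem_insert _ _ : c ∈ G.neighborSet e)
  have ec' : G.Adj e c' := (hN ▸ Set.mem_insert_of_mem _ rfl : c' ∈ G.neighborSet e)
  have hN' : ∀ x, G.Adj e x → x = c ∨ x = c' := by
    intro x hx
    have : x ∈ ({c, c'} : Set V) := hN ▸ hx
    simpa using this
  obtain ⟨d, cd, ed, de⟩ := hout c ec
  obtain ⟨d', cd', ed', de'⟩ := hout c' ec'
  have hd := h.eq_or_adj_of_paths ec ec' cc' cd cd' ed ed' de de'
  have dc' : d ≠ c' := fun k => ed (k ▸ ec')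
  obtain ⟨y, hy⟩ : (({e, c, c', d, d'} : Set V)ᶜ).Nonempty := by
    apply Set.nonempty_of_ncard_ne_zero
    have h1 := Set.ncard_add_ncard_compl ({e, c, c', d, d'} : Set V)
    rw [Nat.card_eq_fintype_card] at h1
    have h2 : ({e, c, c', d, d'} : Set V).ncard ≤ 5 := by
      refine (Set.ncard_insert_le _ _).trans (Nat.succ_le_succ ?_)
      refine (Set.ncard_insert_le _ _).trans (Nat.succ_le_succ ?_)
      refine (Set.ncard_insert_le _ _).trans (Nat.succ_le_succ ?_)
      exact (Set.ncard_insert_le _ _).trans (by simp)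
    omega
  simp only [Set.mem_compl_iff, Set.mem_insert_iff, Set.mem_singleton_iff, not_or] at hy
  obtain ⟨ye, yc, yc', yd, yd'⟩ := hy
  obtain ⟨z, yz, -⟩ := h.exists_adj_ne ye e
  have nc : ∀ x, G.Adj c x → x = e ∨ x = d := fun x =>
    h.eq_or_eq_of_adj ec.ne' ec.symm cd de.symm
  have nc' : ∀ x, G.Adj c' x → x = e ∨ x = d' := fun x =>
    h.eq_or_eq_of_adj ec'.ne' ec'.symm cd' de'.symm
  have nd : ∀ x, G.Adj d x → x = c ∨ x = c' ∨ x = d' := by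
    intro x hx
    rcases hd with rfl | hd
    · rcases h.eq_or_eq_of_adj de cd.symm cd'.symm cc' hx with k | k <;> simp [k]
    · rcases h.eq_or_eq_of_adj de cd.symm hd (fun k => ed' (k ▸ ec)) hx with k | k <;> simp [k]
  have nd' : ∀ x, G.Adj d' x → x = c ∨ x = c' ∨ x = d := by
    intro x hx
    rcases hd with rfl | hd
    · rcases h.eq_or_eq_of_adj de cd.symm cd'.symm cc' hx with k | k <;> simp [k]
    · rcases h.eq_or_eq_of_adj de' cd'.symm hd.symm dc'.symm hx with k | k <;>
        simp [k]
  have ey : ¬ G.Adj e y := fun k => by rcases hN' y k with k | k <;> contradiction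
  have cy : ¬ G.Adj c y := fun k => by rcases nc y k with k | k <;> contradiction
  have zc : z ≠ c := fun k => cy (k ▸ yz.symm)
  have zc' : z ≠ c' := fun k => by
    rcases nc' y (k ▸ yz.symm) with k | k <;> contradiction
  have zd' : z ≠ d' := fun k => by
    rcases nd' y (k ▸ yz.symm) with k | k | k <;> contradiction
  have dy : ¬ G.Adj d y := fun k => by rcases nd y k with k | k | k <;> contradiction
  have d'y : ¬ G.Adj d' y := fun k => by rcases nd' y k with k | k | k <;> contradiction
  have dz : ¬ G.Adj z d := fun k => by rcases nd z k.symm with k | k | k <;> contradiction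
  have zd : z ≠ d := fun k => dy (k ▸ yz.symm)
  have hs : AltCycle G c d z y := ⟨cd, yz.symm, cy, dz, Ne.symm yc, zd⟩
  have m1 := ec.ne
  have m2 := ec'.ne
  have m3 := cd'.ne
  have m4 : z ≠ e := fun k => ey (k ▸ yz.symm)
  have m5 := yz.ne
  have := (h.switch hs).eq_or_adj_of_paths (c := c) (c' := c') (d := y) (d' := d')
    (by rw [switch_adj]; grind) (by rw [switch_adj]; grind) cc' (by rw [switch_adj]; grind)
    (by rw [switch_adj]; grind) (by rw [switch_adj]; grind) (by rw [switch_adj]; grind) ye de'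
  rcases this with k | k
  · exact yd' k
  · have d'c : d' ≠ c := fun k => ed' (k ▸ ec)
    have := G.adj_comm y d'
    rw [switch_adj] at k
    grind

theorem degree_two (h : NearReg G e 2) (hn : Even (vdeg G e)) (hc : 5 ≤ Fintype.card V) :
    vdeg G e + 2 = Fintype.card V ∨ vdeg G e = 2 ∧ Fintype.card V = 5 := by
  by_contra! hcon
  obtain ⟨h1, h2⟩ := hcon
  have h3 := h.le e
  have h4 := h.pos e
  obtain ⟨r, hr⟩ := hn
  by_cases hX : ∃ a b, G.Adj a b ∧ ¬ G.Adj e a ∧ ¬ G.Adj e b ∧ a ≠ e ∧ b ≠ e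
  · obtain ⟨a, b, ab, ea, eb, ae, be⟩ := hX
    rcases Nat.lt_or_ge (vdeg G e) 4 with h5 | h5
    · have h6 : vdeg G e = 2 := by omega
      have := h2 h6
      exact h.false_of_adj_of_eq_two h6 (by omega) ab ea eb ae be
    · exact h.false_of_adj_of_four_le h5 ab ea eb ae be
  · push Not at hX
    have h5 := vdeg_compl G e
    obtain ⟨b, x, ⟨be, eb⟩, ⟨xe, ex⟩, bx⟩ := (Set.one_lt_ncard_iff (Set.toFinite _)).1
      (show 1 < vdeg Gᶜ e by omega)
    obtain ⟨a, ba, ae⟩ := h.exists_adj_ne be.symm e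
    obtain ⟨y, xy, ye⟩ := h.exists_adj_ne xe.symm e
    exact h.false_of_paths (a := a) (b := b) (x := x) (y := y)
      (by_contra fun k => ae (hX b a ba eb k be.symm))
      (by_contra fun k => ye (hX x y xy ex k xe.symm))
      ba.symm xy eb ex be.symm xe.symm bx (fun k => xe.symm (hX b x k eb ex be.symm))

theorem even_sum (h : NearReg G e k) : Even (vdeg G e + (Fintype.card V - 1) * k) := by
  classical
  have h1 := G.sum_degrees_eq_twice_card_edges
  have h2 : ∀ v, G.degree v = vdeg G v := fun v => by
    rw [vdeg, Set.ncard_eq_toFinset_card', SimpleGraph.degree, SimpleGraph.neighborFinset]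
  rw [← Finset.add_sum_erase _ _ (Finset.mem_univ e), h2,
    Finset.sum_congr rfl fun v hv => (h2 v).trans (h.deg v (Finset.ne_of_mem_erase hv))] at h1
  simp only [Finset.sum_const, Finset.card_erase_of_mem (Finset.mem_univ e), Finset.card_univ,
    smul_eq_mul] at h1
  rw [h1]
  exact even_two_mul _

end NearReg

end DegreeTwo

section Families

theorem vdeg_C5 (v : ZMod 5) : vdeg C5 v = 2 := by
  have : C5.neighborSet v = {v + 1, v - 1} := by
    ext w
    simp only [SimpleGraph.mem_neighborSet, C5, SimpleGraph.fromRel_adj, Set.mem_insert_iff,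
      Set.mem_singleton_iff]
    revert v w
    decide
  rw [vdeg, this, Set.ncard_pair]
  clear this
  revert v
  decide

theorem fin_two_ne_iff {i j : Fin 2} : i ≠ j ↔ j = i + 1 := by
  revert i j
  decide

theorem vdeg_mK2 {m : ℕ} (p : Fin m × Fin 2) : vdeg (mK2 m) p = 1 := by
  have : (mK2 m).neighborSet p = {(p.1, p.2 + 1)} := by
    ext ⟨i, j⟩
    simp only [SimpleGraph.mem_neighborSet, mK2, SimpleGraph.fromRel_adj, Set.mem_singleton_iff,
      Prod.ext_iff, ne_eq, ← fin_two_ne_iff, eq_comm (a := i)]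
    tauto
  rw [vdeg, this, Set.ncard_singleton]

theorem vdeg_U2_center {m ℓ : ℕ} : vdeg (U2 m ℓ) (.inr none) = ℓ := by
  have : (U2 m ℓ).neighborSet (.inr none) = Set.range fun i => .inr (some i) := by
    ext (p | _ | i) <;> simp [U2]
  rw [vdeg, this, ← Set.image_univ, Set.ncard_image_of_injective _ fun i j h => by simpa using h,
    Set.ncard_univ, Nat.card_fin]

theorem vdeg_U2 {m ℓ : ℕ} (v : (Fin m × Fin 2) ⊕ Option (Fin ℓ)) (hv : v ≠ .inr none) :
    vdeg (U2 m ℓ) v = 1 := by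
  rcases v with p | _ | i
  · have : (U2 m ℓ).neighborSet (.inl p) = {.inl (p.1, p.2 + 1)} := by
      ext (⟨i, j⟩ | _ | i)
      · simp only [SimpleGraph.mem_neighborSet, U2, SimpleGraph.fromRel_adj,
          Set.mem_singleton_iff, Sum.inl.injEq, Prod.ext_iff, ne_eq,
          ← fin_two_ne_iff, eq_comm (a := i)]
        tauto
      all_goals simp [U2]
    rw [vdeg, this, Set.ncard_singleton]
  · contradiction
  · have : (U2 m ℓ).neighborSet (.inr (some i)) = {.inr none} := by
      ext (p | _ | j) <;> simp [U2]
    rw [vdeg, this, Set.ncard_singleton]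

theorem vdeg_U3_center {m : ℕ} : vdeg (U3 m) none = m * 2 + 2 := by
  have : (U3 m).neighborSet none = ({none, some (.inr 1)} : Set _)ᶜ := by
    ext (_ | p | i)
    · simp
    · simp [U3]
    · fin_cases i <;> simp [U3]
  have h := Set.ncard_add_ncard_compl
    ({none, some (.inr 1)} : Set (Option ((Fin m × Fin 2) ⊕ Fin 3)))
  rw [← this, Set.ncard_pair (by simp)] at h
  simp only [Nat.card_eq_fintype_card, Fintype.card_option, Fintype.card_sum, Fintype.card_prod,
    Fintype.card_fin] at h
  rw [vdeg]
  omega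

theorem vdeg_U3 {m : ℕ} (v : Option ((Fin m × Fin 2) ⊕ Fin 3)) (hv : v ≠ none) :
    vdeg (U3 m) v = 2 := by
  suffices ∃ x y, x ≠ y ∧ (U3 m).neighborSet v = {x, y} by
    obtain ⟨x, y, hxy, h⟩ := this
    rw [vdeg, h, Set.ncard_pair hxy]
  rcases v with _ | p | i
  · contradiction
  · refine ⟨none, some (.inl (p.1, p.2 + 1)), by simp, ?_⟩
    ext (_ | ⟨i, j⟩ | i)
    · simp [U3]
    · simp only [SimpleGraph.mem_neighborSet, U3, SimpleGraph.fromRel_adj, Set.mem_insert_iff,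
        Set.mem_singleton_iff, Option.some.injEq, Sum.inl.injEq, Prod.ext_iff, reduceCtorEq,
        ne_eq, ← fin_two_ne_iff, eq_comm (a := i)]
      tauto
    · simp [U3]
  · fin_cases i
    · refine ⟨none, some (.inr 1), by simp, ?_⟩
      ext (_ | p | i)
      · simp [U3]
      · simp [U3]
      · fin_cases i <;> simp [U3]
    · refine ⟨some (.inr 0), some (.inr 2), by simp, ?_⟩
      ext (_ | p | i)
      · simp [U3]
      · simp [U3]
      · fin_cases i <;> simp [U3]
    · refine ⟨none, some (.inr 1), by simp, ?_⟩
      ext (_ | p | i)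
      · simp [U3]
      · simp [U3]
      · fin_cases i <;> simp [U3]

theorem degMultiset_eq_cons [Fintype V] {G : SimpleGraph V} {e : V} {k : ℕ}
    (h : ∀ v, v ≠ e → vdeg G v = k) :
    degMultiset G = vdeg G e ::ₘ Multiset.replicate (Fintype.card V - 1) k := by
  classical
  rw [degMultiset_eq, ← Finset.insert_erase (Finset.mem_univ e),
    Finset.insert_val_of_notMem (Finset.notMem_erase _ _), Multiset.map_cons]
  congr 1
  rw [Multiset.eq_replicate]
  refine ⟨?_, fun d hd => ?_⟩
  · rw [Multiset.card_map, ← Finset.card_univ, ← Finset.card_erase_of_mem (Finset.mem_univ e)]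
    rfl
  · obtain ⟨v, hv, rfl⟩ := Multiset.mem_map.1 hd
    exact h v (Finset.ne_of_mem_erase hv)

namespace NearReg

variable [Fintype V] {G : SimpleGraph V} {e : V} {k : ℕ}

theorem nonempty_iso (h : NearReg G e k) {W : Type} [Fintype W] {H : SimpleGraph W} {f : W}
    (hf : ∀ w, w ≠ f → vdeg H w = k) (hc : Fintype.card V = Fintype.card W)
    (he : vdeg G e = vdeg H f) : Nonempty (G ≃g H) :=
  h.uni W H (by rw [degMultiset_eq_cons h.deg, degMultiset_eq_cons hf, hc, he])

theorem classification (h : NearReg G e k) (hk : k = 1 ∨ k = 2 ∧ 5 ≤ Fintype.card V) :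
    Nonempty (G ≃g C5) ∨ (∃ m, 2 ≤ m ∧ Nonempty (G ≃g mK2 m)) ∨
      (∃ m ℓ, 1 ≤ m ∧ 2 ≤ ℓ ∧ Nonempty (G ≃g U2 m ℓ)) ∨ ∃ m, 1 ≤ m ∧ Nonempty (G ≃g U3 m) := by
  have hle := h.le e
  have hpos := h.pos e
  obtain ⟨r, hr⟩ := h.even_sum
  rcases hk with rfl | ⟨rfl, hc⟩
  · obtain hD | hD : vdeg G e = 1 ∨ 2 ≤ vdeg G e := by omega
    · refine .inr <| .inl ⟨r, by omega, ?_⟩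
      refine h.nonempty_iso (f := (⟨0, by omega⟩, 0)) (fun w _ => vdeg_mK2 w) ?_ ?_
      · simp only [Fintype.card_prod, Fintype.card_fin]
        omega
      · rw [vdeg_mK2, hD]
    · refine .inr <| .inr <| .inl ⟨r - vdeg G e, vdeg G e, by omega, hD, ?_⟩
      refine h.nonempty_iso (f := .inr none) vdeg_U2 ?_ vdeg_U2_center.symm
      simp only [Fintype.card_sum, Fintype.card_option, Fintype.card_prod, Fintype.card_fin]
      omega
  · have hev : Even (vdeg G e) := ⟨r - (Fintype.card V - 1), by omega⟩
    obtain ⟨s, hs⟩ := id hev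
    rcases h.degree_two hev hc with hD | ⟨hD, hn⟩
    · refine .inr <| .inr <| .inr ⟨s - 1, by omega, ?_⟩
      refine h.nonempty_iso (f := none) vdeg_U3 ?_ (by rw [vdeg_U3_center]; omega)
      simp only [Fintype.card_sum, Fintype.card_option, Fintype.card_prod, Fintype.card_fin]
      omega
    · refine .inl <| h.nonempty_iso (f := 0) (fun w _ => vdeg_C5 w) ?_ (by rw [vdeg_C5, hD])
      rw [hn, ZMod.card]

end NearReg

end Families

/-- **Tyshkevich.** Every indecomposable non-split unigraph `G` with at least two
vertices is such that `G` or its complement is isomorphic to `C₅`, `mK₂` (`m ≥ 2`),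
`U₂(m,ℓ)` (`m ≥ 1`, `ℓ ≥ 2`) or `U₃(m)` (`m ≥ 1`). -/
theorem indecomposable_nonsplit_unigraphs {V : Type} [Fintype V] (G : SimpleGraph V)
    (hindec : ¬ Decomposable G) (hnonsplit : ¬ IsSplit G) (huni : Unigraph G)
    (hcard : 2 ≤ Fintype.card V) :
    (Nonempty (G ≃g C5) ∨ Nonempty (Gᶜ ≃g C5)) ∨
    (∃ m, 2 ≤ m ∧ (Nonempty (G ≃g mK2 m) ∨ Nonempty (Gᶜ ≃g mK2 m))) ∨
    (∃ m ℓ, 1 ≤ m ∧ 2 ≤ ℓ ∧ (Nonempty (G ≃g U2 m ℓ) ∨ Nonempty (Gᶜ ≃g U2 m ℓ))) ∨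
    (∃ m, 1 ≤ m ∧ (Nonempty (G ≃g U3 m) ∨ Nonempty (Gᶜ ≃g U3 m))) := by
  obtain ⟨e, k, hk⟩ := huni.near_regular hindec hnonsplit
  have h := NearReg.of_indecomposable huni hindec hcard hk
  have : Nontrivial V := Fintype.one_lt_card_iff_nontrivial.1 hcard
  obtain ⟨v, hv⟩ := exists_ne e
  have hv1 := h.pos v
  have hv2 := h.le v
  rw [hk v hv] at hv1 hv2
  have hcases : (k = 1 ∨ k = 2 ∧ 5 ≤ Fintype.card V) ∨
      (Fintype.card V - 1 - k = 1 ∨ Fintype.card V - 1 - k = 2 ∧ 5 ≤ Fintype.card V) := by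
    by_contra hn
    exact h.middle_false (by omega) (by omega)
  rcases hcases with hs | hs
  · rcases h.classification hs with H | ⟨m, hm, H⟩ | ⟨m, ℓ, hm, hl, H⟩ | ⟨m, hm, H⟩
    · exact .inl (.inl H)
    · exact .inr (.inl ⟨m, hm, .inl H⟩)
    · exact .inr (.inr (.inl ⟨m, ℓ, hm, hl, .inl H⟩))
    · exact .inr (.inr (.inr ⟨m, hm, .inl H⟩))
  · rcases h.compl.classification hs with H | ⟨m, hm, H⟩ | ⟨m, ℓ, hm, hl, H⟩ | ⟨m, hm, H⟩
    · exact .inl (.inr H)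
    · exact .inr (.inl ⟨m, hm, .inr H⟩)
    · exact .inr (.inr (.inl ⟨m, ℓ, hm, hl, .inr H⟩))
    · exact .inr (.inr (.inr ⟨m, hm, .inr H⟩))

end Tysh
end

section
/- Let G = (G_k,A_k,B_k) ∘ (G_{k−1},A_{k−1},B_{k−1}) ∘ ⋯ ∘ (G_1,A_1,B_1) ∘ G_0 be any iterated composition of split graphs (G_i,A_i,B_i), i = 1,…,k, with a nonempty graph G_0. Then ω(G) = |A_k| + |A_{k−1}| + ⋯ + |A_1| + ω(G_0) and χ(G) = |A_k| + |A_{k−1}| + ⋯ + |A_1| + χ(G_0), where ω denotes the clique number and χ the chromatic number. -/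
namespace Tysh

open SimpleGraph

variable {V : Type}

/-- A homomorphism out of `G` is injective on cliques, so it cannot decrease clique numbers. -/
theorem cliqueNum_le_of_hom {α β : Type} [Finite β] {G : SimpleGraph α} {H : SimpleGraph β}
    (f : G →g H) : G.cliqueNum ≤ H.cliqueNum := by
  classical
  obtain ⟨s, hs⟩ := G.exists_isNClique_cliqueNum
  have hinj : Set.InjOn f s := fun x hx y hy hxy => by
    by_contra hne
    exact (f.map_adj (hs.isClique hx hy hne)).ne hxy
  rw [← hs.card_eq, ← Finset.card_image_of_injOn hinj]
  refine IsClique.card_le_cliqueNum (tc := ?_)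
  rw [Finset.coe_image]
  rintro _ ⟨x, hx, rfl⟩ _ ⟨y, hy, rfl⟩ hne
  exact f.map_adj (hs.isClique hx hy fun h => hne (congrArg f h))

section Join

variable {α β : Type} (G : SimpleGraph α) (A : Set α) (H : SimpleGraph β)

@[simp] theorem comp_adj_inl_inl (a a' : α) :
    (comp G A H).Adj (.inl a) (.inl a') ↔ G.Adj a a' := by
  simp only [comp, fromRel_adj, ne_eq, Sum.inl.injEq, G.adj_comm a' a, or_self]
  exact ⟨fun h => h.2, fun h => ⟨h.ne, h⟩⟩

@[simp] theorem comp_adj_inr_inr (b b' : β) :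
    (comp G A H).Adj (.inr b) (.inr b') ↔ H.Adj b b' := by
  simp only [comp, fromRel_adj, ne_eq, Sum.inr.injEq, H.adj_comm b' b, or_self]
  exact ⟨fun h => h.2, fun h => ⟨h.ne, h⟩⟩

@[simp] theorem comp_adj_inl_inr (a : α) (b : β) :
    (comp G A H).Adj (.inl a) (.inr b) ↔ a ∈ A := by
  simp [comp]

@[simp] theorem comp_adj_inr_inl (a : α) (b : β) :
    (comp G A H).Adj (.inr b) (.inl a) ↔ a ∈ A := by
  simp [comp]

theorem cliqueNum_comp_univ [Finite α] [Finite β] :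
    (comp G Set.univ H).cliqueNum = G.cliqueNum + H.cliqueNum := by
  apply le_antisymm
  · obtain ⟨s, hs⟩ := (comp G Set.univ H).exists_isNClique_cliqueNum
    rw [← hs.card_eq, ← Finset.card_toLeft_add_card_toRight]
    refine add_le_add (IsClique.card_le_cliqueNum (tc := ?_))
      (IsClique.card_le_cliqueNum (tc := ?_))
    · intro x hx y hy hne
      simpa using hs.isClique (Finset.mem_toLeft.1 hx) (Finset.mem_toLeft.1 hy) (by simpa using hne)
    · intro x hx y hy hne
      simpa using hs.isClique (Finset.mem_toRight.1 hx) (Finset.mem_toRight.1 hy)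
        (by simpa using hne)
  · obtain ⟨s, hs⟩ := G.exists_isNClique_cliqueNum
    obtain ⟨t, ht⟩ := H.exists_isNClique_cliqueNum
    rw [← hs.card_eq, ← ht.card_eq, ← Finset.card_disjSum]
    refine IsClique.card_le_cliqueNum (tc := ?_)
    rintro (x | x) hx (y | y) hy hne
    · simpa using hs.isClique (Finset.inl_mem_disjSum.1 hx) (Finset.inl_mem_disjSum.1 hy)
        (by simpa using hne)
    · simp
    · simp
    · simpa using ht.isClique (Finset.inr_mem_disjSum.1 hx) (Finset.inr_mem_disjSum.1 hy)
        (by simpa using hne)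

theorem chromaticNumber_comp_univ :
    (comp G Set.univ H).chromaticNumber = G.chromaticNumber + H.chromaticNumber := by
  classical
  apply le_antisymm
  · by_cases hG : G.chromaticNumber = ⊤
    · simp [hG]
    by_cases hH : H.chromaticNumber = ⊤
    · simp [hH]
    obtain ⟨m, hm⟩ := ENat.ne_top_iff_exists.1 hG
    obtain ⟨n, hn⟩ := ENat.ne_top_iff_exists.1 hH
    obtain ⟨C⟩ := chromaticNumber_le_iff_colorable.1 hm.ge
    obtain ⟨D⟩ := chromaticNumber_le_iff_colorable.1 hn.ge
    rw [← hm, ← hn]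
    let E : (comp G Set.univ H).Coloring (Fin m ⊕ Fin n) := Coloring.mk (Sum.map C D) (by
      rintro (x | x) (y | y) h
      · simpa using C.valid ((comp_adj_inl_inl _ _ _ _ _).1 h)
      · simp
      · simp
      · simpa using D.valid ((comp_adj_inr_inr _ _ _ _ _).1 h))
    simpa using E.colorable.chromaticNumber_le
  · refine le_iInf₂ fun n hn => ?_
    obtain ⟨C⟩ : (comp G Set.univ H).Colorable n := hn
    let P : Set (Fin n) := Set.range fun a => C (.inl a)
    let D : G.Coloring P := Coloring.mk (fun a => ⟨C (.inl a), a, rfl⟩) fun {x y} h hxy =>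
      C.valid ((comp_adj_inl_inl G Set.univ H x y).2 h) (congrArg Subtype.val hxy)
    let E : H.Coloring (Pᶜ : Set (Fin n)) := Coloring.mk
      (fun b => ⟨C (.inr b), fun ⟨a, ha⟩ =>
        C.valid ((comp_adj_inl_inr G Set.univ H a b).2 trivial) ha⟩) fun {x y} h hxy =>
      C.valid ((comp_adj_inr_inr G Set.univ H x y).2 h) (congrArg Subtype.val hxy)
    calc G.chromaticNumber + H.chromaticNumber
        ≤ (Fintype.card P : ℕ∞) + (Fintype.card (Pᶜ : Set (Fin n)) : ℕ∞) :=
          add_le_add D.colorable.chromaticNumber_le E.colorable.chromaticNumber_le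
      _ = n := by
          rw [← Nat.cast_add, ← Fintype.card_sum, Fintype.card_congr (Equiv.Set.sumCompl P),
            Fintype.card_fin]

end Join

theorem cliqueNum_top_eq_card {α : Type} [Fintype α] :
    (⊤ : SimpleGraph α).cliqueNum = Fintype.card α := by
  apply le_antisymm
  · obtain ⟨s, hs⟩ := (⊤ : SimpleGraph α).exists_isNClique_cliqueNum
    exact hs.card_eq ▸ s.card_le_univ
  · exact IsClique.card_le_cliqueNum (t := Finset.univ) (tc := fun _ _ _ _ h => h)

section IterComp

variable {k : ℕ} {Vi : Fin (k + 1) → Type} (Gi : ∀ i, SimpleGraph (Vi i)) (A : ∀ i, Set (Vi i))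

theorem iterComp_adj_same (i : Fin (k + 1)) (x y : Vi i) :
    (iterComp Gi A).Adj ⟨i, x⟩ ⟨i, y⟩ ↔ (Gi i).Adj x y := by
  simp only [iterComp, fromRel_adj, lt_irrefl, false_and, or_false, exists_const,
    (Gi i).adj_comm y x, or_self, ne_eq, Sigma.mk.injEq, true_and, heq_eq_eq]
  exact ⟨fun h => h.2, fun h => ⟨h.ne, h⟩⟩

theorem iterComp_adj_of_lt {i j : Fin (k + 1)} (hij : i < j) (x : Vi j) (y : Vi i) :
    (iterComp Gi A).Adj ⟨j, x⟩ ⟨i, y⟩ ↔ x ∈ A j := by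
  simp [iterComp, hij, hij.ne, hij.ne', hij.not_gt]

variable {Gi A}

/-- The clique parts together with `G₀` span a join inside the iterated composition. -/
theorem nonempty_hom_iterComp (hA : ∀ i, (Gi i).IsClique (A i)) (hA0 : A 0 = ∅) :
    Nonempty (comp (⊤ : SimpleGraph (Σ i, A i)) Set.univ (Gi 0) →g iterComp Gi A) := by
  have key : ∀ i (x : A i) (v : Vi 0), (iterComp Gi A).Adj ⟨i, x⟩ ⟨0, v⟩ := fun i x v => by
    refine (iterComp_adj_of_lt Gi A (Fin.pos_of_ne_zero ?_) _ _).2 x.2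
    rintro rfl
    exact (hA0 ▸ x.2 : x.1 ∈ (∅ : Set (Vi 0)))
  refine ⟨⟨Sum.elim (fun p => ⟨p.1, p.2⟩) (fun v => ⟨0, v⟩), ?_⟩⟩
  rintro (⟨i, x⟩ | v) (⟨j, y⟩ | w) h
  · rcases lt_trichotomy i j with hij | rfl | hij
    · exact ((iterComp_adj_of_lt Gi A hij _ _).2 y.2).symm
    · refine (iterComp_adj_same Gi A i _ _).2 (hA i x.2 y.2 fun hxy => ?_)
      exact (((comp_adj_inl_inl _ _ _ _ _).1 h).ne) (by rw [Subtype.ext hxy])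
    · exact (iterComp_adj_of_lt Gi A hij _ _).2 x.2
  · exact key i x w
  · exact (key j y v).symm
  · exact (iterComp_adj_same Gi A 0 _ _).2 ((comp_adj_inr_inr _ _ _ _ _).1 h)

/-- The iterated composition retracts onto the join of its clique parts and `G₀`: the vertices
of the independent parts can all be sent to an arbitrary vertex of `G₀`. -/
theorem nonempty_iterComp_hom [Nonempty (Vi 0)]
    (hB : ∀ i, i ≠ 0 → IsIndep (Gi i) (A i)ᶜ) (hA0 : A 0 = ∅) :
    Nonempty (iterComp Gi A →g comp (⊤ : SimpleGraph (Σ i, A i)) Set.univ (Gi 0)) := by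
  classical
  obtain ⟨v₀⟩ := ‹Nonempty (Vi 0)›
  let f : (Σ i, Vi i) → (Σ i, A i) ⊕ Vi 0 := fun p =>
    if h : p.2 ∈ A p.1 then .inl ⟨p.1, p.2, h⟩
    else if h0 : p.1 = 0 then .inr (h0 ▸ p.2) else .inr v₀
  have f_mem : ∀ i (x : Vi i) (h : x ∈ A i), f ⟨i, x⟩ = .inl ⟨i, x, h⟩ := fun i x h => dif_pos h
  have f_zero : ∀ x : Vi 0, f ⟨0, x⟩ = .inr x := fun x => by simp [f, hA0]
  have f_not_mem : ∀ i (x : Vi i), x ∉ A i → ∃ v, f ⟨i, x⟩ = .inr v := fun i x h => by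
    by_cases h0 : i = 0
    · exact ⟨h0 ▸ x, by simp [f, h, h0]⟩
    · exact ⟨v₀, by simp [f, h, h0]⟩
  have adj_of_mem : ∀ i j (x : Vi i) (y : Vi j), (⟨i, x⟩ : Σ i, Vi i) ≠ ⟨j, y⟩ → x ∈ A i →
      (comp (⊤ : SimpleGraph (Σ i, A i)) Set.univ (Gi 0)).Adj (f ⟨i, x⟩) (f ⟨j, y⟩) := by
    intro i j x y hne hx
    rw [f_mem i x hx]
    by_cases hy : y ∈ A j
    · rw [f_mem j y hy, comp_adj_inl_inl, top_adj]
      exact fun h => hne (congrArg (fun p : Σ i, A i => (⟨p.1, p.2⟩ : Σ i, Vi i)) h)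
    · obtain ⟨v, hv⟩ := f_not_mem j y hy
      simp [hv]
  refine ⟨⟨f, ?_⟩⟩
  rintro ⟨i, x⟩ ⟨j, y⟩ h
  by_cases hx : x ∈ A i
  · exact adj_of_mem i j x y h.ne hx
  by_cases hy : y ∈ A j
  · exact (adj_of_mem j i y x h.ne' hy).symm
  rcases lt_trichotomy i j with hij | rfl | hij
  · exact absurd ((iterComp_adj_of_lt Gi A hij _ _).1 h.symm) hy
  · have hxy := (iterComp_adj_same Gi A i x y).1 h
    by_cases hi : i = 0
    · subst hi
      rw [f_zero, f_zero]
      exact (comp_adj_inr_inr _ _ _ _ _).2 hxy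
    · exact absurd hxy (hB i hi hx hy hxy.ne)
  · exact absurd ((iterComp_adj_of_lt Gi A hij _ _).1 h) hx

end IterComp

/-- **Whitman.** For any iterated composition
`G = (G_k,A_k,B_k) ∘ ⋯ ∘ (G_1,A_1,B_1) ∘ G_0` of split graphs with a nonempty `G_0`,
`ω(G) = |A_k| + ⋯ + |A_1| + ω(G_0)` and `χ(G) = |A_k| + ⋯ + |A_1| + χ(G_0)`. -/
theorem cliqueNum_chromaticNumber_iterComp {k : ℕ} (Vi : Fin (k + 1) → Type)
    [∀ i, Fintype (Vi i)] [Nonempty (Vi 0)]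
    (Gi : ∀ i, SimpleGraph (Vi i)) (A B : ∀ i, Set (Vi i))
    (hKS : ∀ i, i ≠ 0 → IsKSPartition (Gi i) (A i) (B i))
    (hA0 : A 0 = ∅) (hB0 : B 0 = ∅) :
    (iterComp Gi A).cliqueNum = (∑ i, (A i).ncard) + (Gi 0).cliqueNum ∧
    (iterComp Gi A).chromaticNumber =
      ((∑ i, (A i).ncard : ℕ) : ℕ∞) + (Gi 0).chromaticNumber := by
  classical
  have hA : ∀ i, (Gi i).IsClique (A i) := fun i => by
    by_cases hi : i = 0
    · subst hi
      simp [hA0]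
    · exact (hKS i hi).1
  have hB : ∀ i, i ≠ 0 → IsIndep (Gi i) (A i)ᶜ := fun i hi u hu v hv => by
    obtain ⟨-, hI, hU, -⟩ := hKS i hi
    have hsub : (A i)ᶜ ⊆ B i := Set.compl_subset_iff_union.2 hU
    exact hI (hsub hu) (hsub hv)
  obtain ⟨f⟩ := nonempty_hom_iterComp hA hA0
  obtain ⟨g⟩ := nonempty_iterComp_hom hB hA0
  have hcard : Fintype.card (Σ i, A i) = ∑ i, (A i).ncard := by
    simp [Fintype.card_sigma, Set.ncard_eq_toFinset_card']
  refine ⟨(cliqueNum_le_of_hom g).antisymm (cliqueNum_le_of_hom f) |>.trans ?_,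
    (chromaticNumber_mono_of_hom g).antisymm (chromaticNumber_mono_of_hom f) |>.trans ?_⟩
  · rw [cliqueNum_comp_univ, cliqueNum_top_eq_card, hcard]
  · rw [chromaticNumber_comp_univ, chromaticNumber_top, hcard]

end Tysh
end

section
/- Every indecomposable split graph G with at least two vertices is balanced; that is, G has a KS-partition (A,B) satisfying |A| = ω(G) and |B| = α(G), where ω(G) is the clique number and α(G) the independence number (and this KS-partition is unique). -/
namespace Tysh

open SimpleGraph

variable {V : Type}

/-- Exchanging the two parts of a KS-partition gives a KS-partition of the complement. -/
theorem IsKSPartition.compl {V : Type} {G : SimpleGraph V} {A B : Set V}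
    (h : IsKSPartition G A B) : IsKSPartition Gᶜ B A := by
  obtain ⟨hA, hB, hu, hd⟩ := h
  refine ⟨fun u hu v hv huv => ?_, fun u hu v hv huv hadj => ?_, ?_, hd.symm⟩
  · exact (G.compl_adj u v).2 ⟨huv, hB hu hv huv⟩
  · exact ((G.compl_adj u v).1 hadj).2 (hA hu hv huv)
  · rw [Set.union_comm, hu]

/-- A graph with at least two vertices is decomposable if some vertex is adjacent to all other
vertices of the clique part and to no vertex of the independent part. -/
theorem IsKSPartition.decomposable_of_swing {V : Type} [Fintype V] {G : SimpleGraph V}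
    {A B : Set V} (h : IsKSPartition G A B) (hcard : 2 ≤ Fintype.card V) (x : V)
    (hxA : ∀ a ∈ A, a ≠ x → G.Adj a x) (hxB : ∀ b ∈ B, ¬ G.Adj b x) : Decomposable G := by
  obtain ⟨hA, hB, hu, hd⟩ := h
  have hdiff : A \ {x} ∪ B \ {x} = {x}ᶜ := by
    rw [← Set.union_sdiff_distrib, hu, Set.compl_eq_univ_sdiff]
  have : Nontrivial V := Fintype.one_lt_card_iff_nontrivial.1 hcard
  refine ⟨A \ {x}, B \ {x}, {x}, ?_, hd.mono Set.sdiff_subset Set.sdiff_subset, ?_, ?_,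
    Set.singleton_nonempty x, hA.subset Set.sdiff_subset,
    fun u hu v hv => hB hu.1 hv.1, ?_, ?_⟩
  · rw [hdiff, Set.compl_union_self]
  · rw [hdiff]
    exact disjoint_compl_left
  · rw [hdiff]
    exact exists_ne x
  · rintro a ⟨ha, hax⟩ w rfl
    exact hxA a ha hax
  · rintro b ⟨hb, -⟩ w rfl
    exact hxB b hb

/-- If no vertex of the independent part is adjacent to the whole clique part, then the clique
part is a maximum clique. -/
theorem IsKSPartition.ncard_eq_cliqueNum {V : Type} [Fintype V] {G : SimpleGraph V}
    {A B : Set V} (h : IsKSPartition G A B) (hmiss : ∀ b ∈ B, ∃ a ∈ A, ¬ G.Adj a b) :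
    A.ncard = G.cliqueNum := by
  classical
  obtain ⟨hA, hB, hu, -⟩ := h
  apply le_antisymm
  · rw [Set.ncard_eq_toFinset_card']
    exact SimpleGraph.IsClique.card_le_cliqueNum (tc := by simpa using hA)
  · obtain ⟨C, hC, hCcard⟩ := G.exists_isNClique_cliqueNum
    rw [← hCcard, ← Set.ncard_coe_finset]
    have hmem : ∀ v, v ∈ A ∨ v ∈ B := fun v => (Set.mem_union v A B).1 (hu ▸ Set.mem_univ v)
    by_cases hCB : ∃ b ∈ C, b ∈ B ∧ b ∉ A
    · obtain ⟨b, hbC, hbB, hbA⟩ := hCB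
      obtain ⟨a, haA, hab⟩ := hmiss b hbB
      have hsub : (C : Set V) ⊆ insert b (A \ {a}) := by
        intro c hc
        by_cases hcb : c = b
        · exact Or.inl hcb
        · have hadj := hC hc hbC hcb
          refine Or.inr ⟨(hmem c).resolve_right fun hcB => hB hcB hbB hcb hadj, ?_⟩
          rintro rfl
          exact hab hadj
      calc (C : Set V).ncard ≤ (insert b (A \ {a})).ncard := Set.ncard_le_ncard hsub
        _ ≤ (A \ {a}).ncard + 1 := Set.ncard_insert_le _ _
        _ = A.ncard := Set.ncard_sdiff_singleton_add_one haA
    · refine Set.ncard_le_ncard fun c hc => ?_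
      by_contra hcA
      exact hCB ⟨c, hc, (hmem c).resolve_left hcA, hcA⟩

/-- In a KS-partition of an indecomposable graph with at least two vertices, no vertex of the
clique part belongs to the independent part of another KS-partition. -/
theorem IsKSPartition.disjoint_of_not_decomposable {V : Type} [Fintype V] {G : SimpleGraph V}
    {A B A' B' : Set V} (h : IsKSPartition G A B) (h' : IsKSPartition G A' B')
    (hindec : ¬ Decomposable G) (hcard : 2 ≤ Fintype.card V) : Disjoint A B' := by
  rw [Set.disjoint_left]
  intro x hxA hxB'
  have hmem' : ∀ v, v ∈ A' ∨ v ∈ B' :=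
    fun v => (Set.mem_union v A' B').1 (h'.2.2.1 ▸ Set.mem_univ v)
  by_cases hy : ∃ y ∈ B, G.Adj y x
  · obtain ⟨y, hyB, hyx⟩ := hy
    have hyA' : y ∈ A' := (hmem' y).resolve_right fun hyB' => h'.2.1 hyB' hxB' hyx.ne hyx
    refine hindec (h.decomposable_of_swing hcard y (fun a ha hay => ?_) fun b hb hby =>
      h.2.1 hb hyB hby.ne hby)
    rcases hmem' a with haA' | haB'
    · exact h'.1 haA' hyA' hay
    · by_cases hax : a = x
      · exact hax ▸ hyx.symm
      · exact absurd (h.1 ha hxA hax) (h'.2.1 haB' hxB' hax)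
  · exact hindec (h.decomposable_of_swing hcard x (fun a ha hax => h.1 ha hxA hax)
      fun b hb hbx => hy ⟨b, hb, hbx⟩)

/-- Every indecomposable split graph with at least two vertices is balanced: it has a
(unique) KS-partition `(A,B)` with `|A| = ω(G)` and `|B| = α(G)`. -/
theorem indecomposable_split_balanced {V : Type} [Fintype V] (G : SimpleGraph V)
    (hsplit : IsSplit G) (hindec : ¬ Decomposable G) (hcard : 2 ≤ Fintype.card V) :
    ∃ A B, IsKSPartition G A B ∧ A.ncard = G.cliqueNum ∧ B.ncard = indepNum G ∧
      ∀ A' B', IsKSPartition G A' B' → A' = A ∧ B' = B := by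
  obtain ⟨A, B, h⟩ := hsplit
  refine ⟨A, B, h, h.ncard_eq_cliqueNum fun b hb => ?_,
    h.compl.ncard_eq_cliqueNum fun a ha => ?_, fun A' B' h' => ?_⟩
  · by_contra! hall
    exact hindec (h.decomposable_of_swing hcard b (fun a ha _ => hall a ha)
      fun b' hb' hadj => h.2.1 hb' hb hadj.ne hadj)
  · by_contra! hall
    exact hindec (h.decomposable_of_swing hcard a (fun a' ha' hne => h.1 ha' ha hne)
      fun b hb => ((G.compl_adj b a).1 (hall b hb)).2)
  · have hAB' := h.disjoint_of_not_decomposable h' hindec hcard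
    have hA'B := h'.disjoint_of_not_decomposable h hindec hcard
    have hBc := IsCompl.compl_eq ⟨h.2.2.2, codisjoint_iff.2 h.2.2.1⟩
    have hBc' := IsCompl.compl_eq ⟨h'.2.2.2, codisjoint_iff.2 h'.2.2.1⟩
    have hA : A' = A := by
      apply le_antisymm
      · rwa [← hBc, disjoint_compl_right_iff] at hA'B
      · rwa [← hBc', disjoint_compl_right_iff] at hAB'
    exact ⟨hA, by rw [← hBc, ← hBc', hA]⟩

end Tysh
end

section
/- Let G be a balanced split graph with KS-partition (A,B). Then every automorphism π of G satisfies π(A) = A and π(B) = B. -/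
namespace Tysh

open SimpleGraph

variable {V : Type}

/-- A clique of maximum size has a non-neighbour of every outside vertex. -/
theorem exists_not_adj_of_ncard_eq_cliqueNum {V : Type} [Finite V] {G : SimpleGraph V}
    {A : Set V} (hA : G.IsClique A) (hcard : A.ncard = G.cliqueNum) {b : V} (hb : b ∉ A) :
    ∃ a ∈ A, ¬ G.Adj b a := by
  by_contra! h
  have hclique : G.IsClique (insert b A) := hA.insert fun a ha _ => h a ha
  have hfin := Set.toFinite (insert b A)
  have hle := SimpleGraph.IsClique.card_le_cliqueNum (G := G) (t := hfin.toFinset)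
    (tc := by simpa using hclique)
  rw [← Set.ncard_eq_toFinset_card _ hfin, Set.ncard_insert_of_notMem hb] at hle
  omega

theorem IsIndep.isClique_compl {V : Type} {G : SimpleGraph V} {B : Set V} (hB : IsIndep G B) :
    Gᶜ.IsClique B :=
  fun _ hu _ hv huv => ⟨huv, hB hu hv huv⟩

theorem IsKSPartition.mem_or_mem {V : Type} {G : SimpleGraph V} {A B : Set V}
    (h : IsKSPartition G A B) (v : V) : v ∈ A ∨ v ∈ B :=
  h.2.2.1.ge (Set.mem_univ v)

theorem IsKSPartition.notMem_left {V : Type} {G : SimpleGraph V} {A B : Set V}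
    (h : IsKSPartition G A B) {v : V} (hv : v ∈ B) : v ∉ A :=
  fun hA => Set.disjoint_left.1 h.2.2.2 hA hv

theorem IsKSPartition.right_eq_compl {V : Type} {G : SimpleGraph V} {A B : Set V}
    (h : IsKSPartition G A B) : B = Aᶜ := by
  ext v
  exact ⟨h.notMem_left, (h.mem_or_mem v).resolve_left⟩

/-- A balanced KS-partition is the only KS-partition. -/
theorem IsKSPartition.left_eq_of_balanced {V : Type} [Finite V] {G : SimpleGraph V}
    {A B A₀ B₀ : Set V} (h : IsKSPartition G A B) (h₀ : IsKSPartition G A₀ B₀)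
    (hA₀ : A₀.ncard = G.cliqueNum) (hB₀ : B₀.ncard = indepNum G) : A = A₀ := by
  have non_adj {b : V} (hb : b ∈ B₀) (hbA : b ∈ A) : ∃ a ∈ A₀, a ∈ B ∧ ¬ G.Adj b a := by
    obtain ⟨a, ha, hba⟩ := exists_not_adj_of_ncard_eq_cliqueNum h₀.1 hA₀ (h₀.notMem_left hb)
    have hne : b ≠ a := fun e => h₀.notMem_left hb (e ▸ ha)
    exact ⟨a, ha, (h.mem_or_mem a).resolve_left fun haA => hba (h.1 hbA haA hne), hba⟩
  have hsub : A₀ ⊆ A := by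
    intro a ha
    by_contra haA
    have haB := (h.mem_or_mem a).resolve_left haA
    obtain ⟨b, hb, hab⟩ := exists_not_adj_of_ncard_eq_cliqueNum h₀.2.1.isClique_compl hB₀
      (fun hb => h₀.notMem_left hb ha)
    have hne : a ≠ b := fun e => h₀.notMem_left hb (e ▸ ha)
    have hadj : G.Adj a b := by
      by_contra hn
      exact hab ⟨hne, hn⟩
    have hbA := (h.mem_or_mem b).resolve_right fun hbB => h.2.1 haB hbB hne hadj
    obtain ⟨a', ha', ha'B, hba'⟩ := non_adj hb hbA
    have hne' : a ≠ a' := by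
      rintro rfl
      exact hba' hadj.symm
    exact h.2.1 haB ha'B hne' (h₀.1 ha ha' hne')
  refine Set.Subset.antisymm (fun b hbA => ?_) hsub
  by_contra hb
  obtain ⟨a, ha, haB, -⟩ := non_adj ((h₀.mem_or_mem b).resolve_left hb) hbA
  exact h.notMem_left haB (hsub ha)

/-- Automorphisms carry KS-partitions to KS-partitions. -/
theorem IsKSPartition.image {V : Type} {G : SimpleGraph V} {A B : Set V}
    (h : IsKSPartition G A B) (π : G ≃g G) : IsKSPartition G (π '' A) (π '' B) := by
  refine ⟨?_, ?_, ?_, ?_⟩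
  · rintro _ ⟨u, hu, rfl⟩ _ ⟨v, hv, rfl⟩ huv
    exact π.map_adj_iff.2 (h.1 hu hv fun e => huv (e ▸ rfl))
  · rintro _ ⟨u, hu, rfl⟩ _ ⟨v, hv, rfl⟩ huv hadj
    exact h.2.1 hu hv (fun e => huv (e ▸ rfl)) (π.map_adj_iff.1 hadj)
  · rw [← Set.image_union, h.2.2.1, Set.image_univ, π.surjective.range_eq]
  · exact (Set.disjoint_image_iff π.injective).2 h.2.2.2

/-- Every automorphism of a balanced split graph `G` with KS-partition `(A,B)` maps `A`
onto `A` and `B` onto `B`. -/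
theorem balanced_aut_fixes_parts {V : Type} [Fintype V] (G : SimpleGraph V) (A B : Set V)
    (hKS : IsKSPartition G A B)
    (hbal : ∃ A₀ B₀, IsKSPartition G A₀ B₀ ∧
      A₀.ncard = G.cliqueNum ∧ B₀.ncard = indepNum G)
    (π : G ≃g G) : ⇑π '' A = A ∧ ⇑π '' B = B := by
  obtain ⟨A₀, B₀, h₀, hA₀, hB₀⟩ := hbal
  have himage := hKS.image π
  have hA : π '' A = A := (himage.left_eq_of_balanced h₀ hA₀ hB₀).trans
    (hKS.left_eq_of_balanced h₀ hA₀ hB₀).symm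
  exact ⟨hA, by rw [himage.right_eq_compl, hA, hKS.right_eq_compl]⟩

end Tysh
end

section
/- Let G* = (G,A,B) ∘ H be the composition of a split graph G with KS-partition (A,B) and a nonempty graph H, and suppose one of the following holds: (a) G is an indecomposable split graph with at least two vertices; (b) A = V(G) and B = ∅ (so G is a complete graph), H has at least two vertices, and H has no dominant vertex; (c) A = ∅ and B = V(G) (so G is an edgeless graph), H has at least two vertices, and H has no isolated vertex. Then every automorphism of G* maps V(G) onto V(G) and V(H) onto V(H), and the map sending an automorphism π of G* to the pair of its restrictions (π|_{V(G)}, π|_{V(H)}) is a group isomorphism from Aut(G*) onto Aut(G) × Aut(H). -/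
namespace Tysh

open SimpleGraph

variable {V : Type}

section comp

variable {α β : Type} {G : SimpleGraph α} {A B : Set α} {H : SimpleGraph β}

@[simp] lemma comp_inl_inl {x y : α} :
    (comp G A H).Adj (Sum.inl x) (Sum.inl y) ↔ G.Adj x y := by
  simp only [comp, SimpleGraph.fromRel_adj, ne_eq, Sum.inl.injEq, G.adj_comm y x, or_self]
  exact ⟨fun h => h.2, fun h => ⟨h.ne, h⟩⟩

@[simp] lemma comp_inr_inr {x y : β} :
    (comp G A H).Adj (Sum.inr x) (Sum.inr y) ↔ H.Adj x y := by
  simp only [comp, SimpleGraph.fromRel_adj, ne_eq, Sum.inr.injEq, H.adj_comm y x, or_self]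
  exact ⟨fun h => h.2, fun h => ⟨h.ne, h⟩⟩

@[simp] lemma comp_inl_inr {x : α} {y : β} :
    (comp G A H).Adj (Sum.inl x) (Sum.inr y) ↔ x ∈ A := by
  simp [comp]

@[simp] lemma comp_inr_inl {x : α} {y : β} :
    (comp G A H).Adj (Sum.inr y) (Sum.inl x) ↔ x ∈ A := by
  simp [comp]

lemma decomposable_of_dominant [Nontrivial α] (v : α) (h : ∀ w, w ≠ v → G.Adj v w) :
    Decomposable G := by
  obtain ⟨u, hu⟩ := exists_ne v
  refine ⟨{v}, ∅, {v}ᶜ, by simp, by simp, ?_, by simp, ⟨u, hu⟩, by simp, ?_, ?_, by simp⟩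
  · simp
  · simp [IsIndep]
  · rintro a rfl w hw
    exact h w hw

lemma decomposable_of_isolated [Nontrivial α] (v : α) (h : ∀ w, ¬ G.Adj v w) :
    Decomposable G := by
  obtain ⟨u, hu⟩ := exists_ne v
  refine ⟨∅, {v}, {v}ᶜ, by simp, by simp, ?_, by simp, ⟨u, hu⟩, by simp, ?_, by simp, ?_⟩
  · simp
  · simp [IsIndep]
  · rintro a rfl w _
    exact h w

lemma IsKSPartition.mem_right (h : IsKSPartition G A B) {x : α} : x ∈ B ↔ x ∉ A := by
  obtain ⟨-, -, hu, hd⟩ := h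
  refine ⟨fun hB hA => Set.disjoint_left.1 hd hA hB, fun hA => ?_⟩
  have hx : x ∈ A ∪ B := hu ▸ Set.mem_univ x
  exact hx.resolve_left hA

/-- An indecomposable graph with at least two vertices has at most one KS-partition. -/
lemma IsKSPartition.left_unique [Nontrivial α] {A' B' : Set α} (hG : ¬ Decomposable G)
    (h : IsKSPartition G A B) (h' : IsKSPartition G A' B') : A = A' := by
  by_contra hne
  have hW : ∃ v, ¬ (v ∈ A ↔ v ∈ A') := by
    by_contra! hc
    exact hne (Set.ext hc)
  obtain ⟨v, hv⟩ := hW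
  have hB : ∀ x, x ∉ A → x ∈ B := fun x => h.mem_right.2
  have hB' : ∀ x, x ∉ A' → x ∈ B' := fun x => h'.mem_right.2
  have hadj : ∀ x y, x ≠ y → (x ∈ A ∧ y ∈ A ∨ x ∈ A' ∧ y ∈ A') → G.Adj x y := by
    rintro x y hxy (⟨hx, hy⟩ | ⟨hx, hy⟩)
    exacts [h.1 hx hy hxy, h'.1 hx hy hxy]
  have hnadj : ∀ x y, x ≠ y → (x ∉ A ∧ y ∉ A ∨ x ∉ A' ∧ y ∉ A') → ¬ G.Adj x y := by
    rintro x y hxy (⟨hx, hy⟩ | ⟨hx, hy⟩)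
    exacts [h.2.1 (hB x hx) (hB y hy) hxy, h'.2.1 (hB' x hx) (hB' y hy) hxy]
  by_cases hC : ∃ u, u ∈ A ↔ u ∈ A'
  · obtain ⟨u, hu⟩ := hC
    refine hG ⟨A ∩ A', Aᶜ ∩ A'ᶜ, {w | ¬ (w ∈ A ↔ w ∈ A')}, ?_, ?_, ?_, ⟨u, ?_⟩, ⟨v, hv⟩,
      h.1.subset Set.inter_subset_left, ?_, ?_, ?_⟩
    · ext x
      simp only [Set.mem_union, Set.mem_inter_iff, Set.mem_compl_iff, Set.mem_ofPred_eq,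
        Set.mem_univ, iff_true]
      tauto
    · exact Set.disjoint_left.2 fun x hx hx' => hx'.1 hx.1
    · refine Set.disjoint_left.2 fun x hx hx' => ?_
      simp only [Set.mem_union, Set.mem_inter_iff, Set.mem_compl_iff, Set.mem_ofPred_eq] at hx hx'
      tauto
    · simp only [Set.mem_union, Set.mem_inter_iff, Set.mem_compl_iff]
      tauto
    · exact fun x hx y hy hxy => hnadj x y hxy (Or.inl ⟨hx.1, hy.1⟩)
    · intro x hx y hy
      simp only [Set.mem_ofPred_eq] at hy
      have hxy : x ≠ y := by
        rintro rfl
        exact hy (iff_of_true hx.1 hx.2)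
      refine hadj x y hxy ?_
      have := hx.1
      have := hx.2
      tauto
    · intro x hx y hy
      simp only [Set.mem_ofPred_eq] at hy
      have hxy : x ≠ y := by
        rintro rfl
        exact hy (iff_of_false hx.1 hx.2)
      refine hnadj x y hxy ?_
      have : x ∉ A := hx.1
      have : x ∉ A' := hx.2
      tauto
  · push Not at hC
    obtain ⟨u, w, huw⟩ := exists_pair_ne α
    have hopp : ∀ x y, x ≠ y → ¬ (x ∈ A ↔ y ∈ A) := by
      intro x y hxy hiff
      have hx := hC x
      have hy := hC y
      by_cases hxA : x ∈ A
      · exact hnadj x y hxy (by tauto) (hadj x y hxy (by tauto))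
      · exact hnadj x y hxy (by tauto) (hadj x y hxy (by tauto))
    have hall : ∀ x, x ≠ u → x = w := by
      intro x hxu
      by_contra hxw
      have := hopp x u hxu
      have := hopp x w hxw
      have := hopp u w huw
      tauto
    by_cases hauw : G.Adj u w
    · exact hG (decomposable_of_dominant u fun x hx => hall x hx ▸ hauw)
    · refine hG (decomposable_of_isolated u fun x hx => hauw ?_)
      exact hall x hx.ne' ▸ hx

/-- Automorphisms of an indecomposable split graph preserve its clique part. -/
lemma IsKSPartition.iso_mem_iff [Nontrivial α] (hG : ¬ Decomposable G)
    (h : IsKSPartition G A B) (g : G ≃g G) (x : α) : g x ∈ A ↔ x ∈ A := by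
  have h' : IsKSPartition G (g ⁻¹' A) (g ⁻¹' B) := by
    refine ⟨fun u hu v hv huv => ?_, fun u hu v hv huv hadj => ?_, ?_, h.2.2.2.preimage g⟩
    · exact g.map_adj_iff.1 (h.1 hu hv (g.injective.ne huv))
    · exact h.2.1 hu hv (g.injective.ne huv) (g.map_adj_iff.2 hadj)
    · rw [← Set.preimage_union, h.2.2.1, Set.preimage_univ]
  conv_rhs => rw [h.left_unique hG h']
  rfl

/-- If `G` is an indecomposable split graph with at least two vertices, automorphisms of
`(G,A,B) ∘ H` map `V(G)` into itself. -/
lemma comp_iso_inl_of_indecomposable [Finite α] [Nontrivial α] (hG : ¬ Decomposable G)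
    (h : IsKSPartition G A B) (π : comp G A H ≃g comp G A H) (x : α) :
    ∃ x', π (Sum.inl x) = Sum.inl x' := by
  by_cases hW : ∃ x y, π (Sum.inr y) = Sum.inl x
  · exfalso
    by_cases hX : ∃ x a, π (Sum.inl a) = Sum.inl x
    · obtain ⟨x₀, y₀, h₀⟩ := hW
      obtain ⟨x₁, a₁, h₁⟩ := hX
      have key : ∀ {p q : α ⊕ β} {u v : α}, π p = Sum.inl u → π q = Sum.inl v →
          (G.Adj u v ↔ (comp G A H).Adj p q) := by
        intro p q u v hp hq
        rw [← π.map_adj_iff, hp, hq, comp_inl_inl]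
      have keq : ∀ {p q : α ⊕ β} {u : α}, π p = Sum.inl u → π q = Sum.inl u → p = q :=
        fun hp hq => π.injective (hp.trans hq.symm)
      refine hG ⟨{u | ∃ a ∈ A, π (Sum.inl a) = Sum.inl u},
        {u | ∃ a, a ∉ A ∧ π (Sum.inl a) = Sum.inl u},
        {u | ∃ y, π (Sum.inr y) = Sum.inl u}, ?_, ?_, ?_, ⟨x₁, ?_⟩, ⟨x₀, y₀, h₀⟩,
        ?_, ?_, ?_, ?_⟩
      · refine Set.eq_univ_of_forall fun u => ?_
        obtain ⟨p, hp⟩ := π.surjective (Sum.inl u)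
        rcases p with a | y
        · by_cases ha : a ∈ A
          · exact Or.inl (Or.inl ⟨a, ha, hp⟩)
          · exact Or.inl (Or.inr ⟨a, ha, hp⟩)
        · exact Or.inr ⟨y, hp⟩
      · refine Set.disjoint_left.2 ?_
        rintro u ⟨a, ha, hau⟩ ⟨b, hb, hbu⟩
        exact hb (Sum.inl_injective (keq hau hbu) ▸ ha)
      · refine Set.disjoint_left.2 ?_
        rintro u (⟨a, -, hau⟩ | ⟨a, -, hau⟩) ⟨y, hy⟩ <;> exact Sum.inl_ne_inr (keq hau hy)
      · by_cases ha : a₁ ∈ A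
        · exact Or.inl ⟨a₁, ha, h₁⟩
        · exact Or.inr ⟨a₁, ha, h₁⟩
      · rintro u ⟨a, ha, hau⟩ v ⟨b, hb, hbv⟩ huv
        refine (key hau hbv).2 (comp_inl_inl.2 (h.1 ha hb ?_))
        rintro rfl
        exact huv (Sum.inl_injective (hau.symm.trans hbv))
      · rintro u ⟨a, ha, hau⟩ v ⟨b, hb, hbv⟩ huv hadj
        have hab := comp_inl_inl.1 ((key hau hbv).1 hadj)
        exact h.2.1 (h.mem_right.2 ha) (h.mem_right.2 hb) hab.ne hab
      · rintro u ⟨a, ha, hau⟩ v ⟨y, hyv⟩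
        exact (key hau hyv).2 (comp_inl_inr.2 ha)
      · rintro u ⟨a, ha, hau⟩ v ⟨y, hyv⟩ hadj
        exact ha (comp_inl_inr.1 ((key hau hyv).1 hadj))
    · push Not at hX
      have hinr : ∀ a, ∃ y, π (Sum.inl a) = Sum.inr y := by
        intro a
        rcases hp : π (Sum.inl a) with u | y
        · exact absurd hp (hX u a)
        · exact ⟨y, rfl⟩
      have hinr' : ∀ u, ∃ y, π (Sum.inr y) = Sum.inl u := by
        intro u
        obtain ⟨a | y, hp⟩ := π.surjective (Sum.inl u)
        · exact absurd hp (hX u a)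
        · exact ⟨y, hp⟩
      have hswap : ∀ u v, u ∈ A ↔ v ∈ A := by
        intro u v
        obtain ⟨y, hy⟩ := hinr v
        obtain ⟨z, hz⟩ := hinr' u
        rw [← comp_inl_inr (G := G) (H := H) (y := y), ← hy, ← hz, π.map_adj_iff, comp_inr_inl]
      by_cases hx : x ∈ A
      · exact hG (decomposable_of_dominant x fun w hw => h.1 hx ((hswap x w).1 hx) hw.symm)
      · refine hG (decomposable_of_isolated x fun w hw => ?_)
        exact h.2.1 (h.mem_right.2 hx) (h.mem_right.2 fun hwA => hx ((hswap x w).2 hwA)) hw.ne hw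
  · push Not at hW
    have hpre : ∀ u, ∃ a, π (Sum.inl a) = Sum.inl u := by
      intro u
      obtain ⟨a | y, hp⟩ := π.surjective (Sum.inl u)
      · exact ⟨a, hp⟩
      · exact absurd hp (hW u y)
    choose f hf using hpre
    have hinj : Function.Injective f := fun u v huv =>
      Sum.inl_injective ((hf u).symm.trans (huv ▸ hf v))
    obtain ⟨u, rfl⟩ := Finite.surjective_of_injective hinj x
    exact ⟨u, hf u⟩

lemma comp_iso_inl_of_complete (hA : ∀ x y, x ≠ y → G.Adj x y) (hA' : A = Set.univ)
    (hH : ¬ ∃ v : β, ∀ w, w ≠ v → H.Adj v w) (π : comp G A H ≃g comp G A H) (x : α) :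
    ∃ x', π (Sum.inl x) = Sum.inl x' := by
  rcases hp : π (Sum.inl x) with u | y
  · exact ⟨u, rfl⟩
  · refine (hH ⟨y, fun w hw => ?_⟩).elim
    obtain ⟨p, hpw⟩ := π.surjective (Sum.inr w)
    rw [← comp_inr_inr (G := G) (A := A), ← hp, ← hpw, π.map_adj_iff]
    rcases p with a | z
    · refine comp_inl_inl.2 (hA x a ?_)
      rintro rfl
      exact hw (Sum.inr_injective (hpw.symm.trans hp))
    · simp [hA']

lemma comp_iso_inl_of_edgeless (hB : ∀ x y, ¬ G.Adj x y) (hA : A = ∅)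
    (hH : ¬ ∃ v : β, ∀ w, ¬ H.Adj v w) (π : comp G A H ≃g comp G A H) (x : α) :
    ∃ x', π (Sum.inl x) = Sum.inl x' := by
  rcases hp : π (Sum.inl x) with u | y
  · exact ⟨u, rfl⟩
  · refine (hH ⟨y, fun w => ?_⟩).elim
    obtain ⟨p, hpw⟩ := π.surjective (Sum.inr w)
    rw [← comp_inr_inr (G := G) (A := A), ← hp, ← hpw, π.map_adj_iff]
    rcases p with a | z
    · simpa using hB x a
    · simp [hA]

/-- Automorphisms of the two factors, the first one preserving the clique part, glue to an
automorphism of the composition. -/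
def compIso (g : G ≃g G) (h : H ≃g H) (hg : ∀ x, g x ∈ A ↔ x ∈ A) :
    comp G A H ≃g comp G A H where
  toEquiv := Equiv.sumCongr g.toEquiv h.toEquiv
  map_rel_iff' := by
    rintro (x | x) (y | y)
    · simpa using g.map_adj_iff
    · simpa using hg x
    · simpa using hg y
    · simpa using h.map_adj_iff

lemma exists_iso_of_comp_iso
    (hinl : ∀ (π : comp G A H ≃g comp G A H) x, ∃ x', π (Sum.inl x) = Sum.inl x')
    (hinr : ∀ (π : comp G A H ≃g comp G A H) y, ∃ y', π (Sum.inr y) = Sum.inr y')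
    (π : comp G A H ≃g comp G A H) :
    ∃ p : (G ≃g G) × (H ≃g H), (∀ x, π (Sum.inl x) = Sum.inl (p.1 x)) ∧
      ∀ y, π (Sum.inr y) = Sum.inr (p.2 y) := by
  choose f hf using hinl π
  choose f' hf' using hinl π.symm
  choose g hg using hinr π
  choose g' hg' using hinr π.symm
  refine ⟨⟨⟨⟨f, f', fun x => ?_, fun x => ?_⟩, fun {x y} => ?_⟩,
    ⟨⟨g, g', fun x => ?_, fun x => ?_⟩, fun {x y} => ?_⟩⟩, hf, hg⟩
  · exact Sum.inl_injective (by rw [← hf', ← hf, π.symm_apply_apply])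
  · exact Sum.inl_injective (by rw [← hf, ← hf', π.apply_symm_apply])
  · change G.Adj (f x) (f y) ↔ _
    rw [← comp_inl_inl (A := A) (H := H), ← hf, ← hf, π.map_adj_iff, comp_inl_inl]
  · exact Sum.inr_injective (by rw [← hg', ← hg, π.symm_apply_apply])
  · exact Sum.inr_injective (by rw [← hg, ← hg', π.apply_symm_apply])
  · change H.Adj (g x) (g y) ↔ _
    rw [← comp_inr_inr (G := G) (A := A), ← hg, ← hg, π.map_adj_iff, comp_inr_inr]

end comp

/-- Let `G* = (G,A,B) ∘ H` with `H` nonempty, and assume (a) `G` is indecomposable with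
at least two vertices, or (b) `G` is complete (`A = V(G)`, `B = ∅`), `H` has at least
two vertices and no dominant vertex, or (c) `G` is edgeless (`A = ∅`, `B = V(G)`),
`H` has at least two vertices and no isolated vertex. Then every automorphism of `G*`
preserves `V(G)` and `V(H)`, and restriction is a group isomorphism
`Aut(G*) ≅ Aut(G) × Aut(H)`. -/
theorem aut_comp_factors {α β : Type} [Fintype α] [Fintype β]
    (G : SimpleGraph α) (A B : Set α) (H : SimpleGraph β) [Nonempty β]
    (hKS : IsKSPartition G A B)
    (hcases :
      (¬ Decomposable G ∧ 2 ≤ Fintype.card α) ∨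
      (A = Set.univ ∧ B = ∅ ∧ 2 ≤ Fintype.card β ∧
        ¬ ∃ v : β, ∀ w, w ≠ v → H.Adj v w) ∨
      (A = ∅ ∧ B = Set.univ ∧ 2 ≤ Fintype.card β ∧
        ¬ ∃ v : β, ∀ w, ¬ H.Adj v w)) :
    (∀ π : comp G A H ≃g comp G A H,
      (∀ x : α, ∃ x', π (Sum.inl x) = Sum.inl x') ∧
      (∀ y : β, ∃ y', π (Sum.inr y) = Sum.inr y')) ∧
    ∃ Φ : (comp G A H ≃g comp G A H) → (G ≃g G) × (H ≃g H),
      Function.Bijective Φ ∧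
      (∀ π x, π (Sum.inl x) = Sum.inl ((Φ π).1 x)) ∧
      (∀ π y, π (Sum.inr y) = Sum.inr ((Φ π).2 y)) ∧
      (∀ π π', Φ (π.trans π') = ((Φ π).1.trans (Φ π').1, (Φ π).2.trans (Φ π').2)) := by
  obtain ⟨hinl, hA⟩ : (∀ (π : comp G A H ≃g comp G A H) x, ∃ x', π (Sum.inl x) = Sum.inl x') ∧
      ∀ (g : G ≃g G) x, g x ∈ A ↔ x ∈ A := by
    rcases hcases with ⟨hG, hcard⟩ | ⟨hA, -, -, hH⟩ | ⟨hA, hB, -, hH⟩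
    · have : Nontrivial α := Fintype.one_lt_card_iff_nontrivial.1 hcard
      exact ⟨comp_iso_inl_of_indecomposable hG hKS, hKS.iso_mem_iff hG⟩
    · have hG : ∀ x y, x ≠ y → G.Adj x y := fun x y hxy =>
        hKS.1 (hA ▸ Set.mem_univ x) (hA ▸ Set.mem_univ y) hxy
      exact ⟨comp_iso_inl_of_complete hG hA hH, by simp [hA]⟩
    · have hG : ∀ x y, ¬ G.Adj x y := fun x y hxy =>
        hKS.2.1 (hB ▸ Set.mem_univ x) (hB ▸ Set.mem_univ y) hxy.ne hxy
      exact ⟨comp_iso_inl_of_edgeless hG hA hH, by simp [hA]⟩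
  have hinr : ∀ (π : comp G A H ≃g comp G A H) y, ∃ y', π (Sum.inr y) = Sum.inr y' := by
    intro π y
    rcases hp : π (Sum.inr y) with x | z
    · obtain ⟨x', hx'⟩ := hinl π.symm x
      rw [← hp, π.symm_apply_apply] at hx'
      exact absurd hx' Sum.inr_ne_inl
    · exact ⟨z, rfl⟩
  refine ⟨fun π => ⟨hinl π, hinr π⟩, ?_⟩
  choose Φ hΦ₁ hΦ₂ using exists_iso_of_comp_iso hinl hinr
  have huniq : ∀ π (p : (G ≃g G) × (H ≃g H)), (∀ x, π (Sum.inl x) = Sum.inl (p.1 x)) →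
      (∀ y, π (Sum.inr y) = Sum.inr (p.2 y)) → Φ π = p := by
    intro π p h₁ h₂
    refine Prod.ext (RelIso.ext fun x => ?_) (RelIso.ext fun y => ?_)
    · exact Sum.inl_injective ((hΦ₁ π x).symm.trans (h₁ x))
    · exact Sum.inr_injective ((hΦ₂ π y).symm.trans (h₂ y))
  refine ⟨Φ, ⟨fun π π' hππ' => RelIso.ext ?_, fun p => ?_⟩, hΦ₁, hΦ₂, fun π π' => ?_⟩
  · rintro (x | y)
    · rw [hΦ₁, hΦ₁, hππ']
    · rw [hΦ₂, hΦ₂, hππ']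
  · exact ⟨compIso p.1 p.2 (hA p.1), huniq _ p (fun _ => rfl) fun _ => rfl⟩
  · refine huniq _ _ (fun x => ?_) fun y => ?_
    · change π' (π (Sum.inl x)) = _
      rw [hΦ₁, hΦ₁]
      rfl
    · change π' (π (Sum.inr y)) = _
      rw [hΦ₂, hΦ₂]
      rfl

end Tysh
end
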